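/- Let S ⊆ ℝ² be a nice shape, let X ⊆ ℝ² be a finite point set in general position with respect to S, and let k be a positive integer with k ≤ |X|. Then the number of hyperedges of the k-uniform S-capturing hypergraph ℋ(X,S,k) is exactly (2k−1)·|X| − k² + 1 − Σ_{i=1}^{k−1} a_i. -/

import Mathlib

open Set

noncomputable section

/-- The Euclidean plane. -/
abbrev Pt : Type := EuclideanSpace ℝ (Fin 2)

/-- `T` is an `S`-range: a homothetic copy of `S` with positive ratio. -/
def IsRange (S T : Set Pt) : Prop :=
  ∃ (c : ℝ) (v : Pt), 0 < c ∧ T = (fun x => c • x + v) '' S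

/-- A straight line in the plane. -/
def IsLine (l : Set Pt) : Prop :=
  ∃ (f : Pt →ₗ[ℝ] ℝ) (a : ℝ), f ≠ 0 ∧ l = {x | f x = a}

/-- A closed halfplane. -/
def IsClosedHalfplane (H : Set Pt) : Prop :=
  ∃ (f : Pt →ₗ[ℝ] ℝ) (a : ℝ), f ≠ 0 ∧ H = {x | f x ≤ a}

/-- An open halfplane bounded by the line through `p` and `q`. -/
def IsOpenHalfplaneOf (p q : Pt) (L : Set Pt) : Prop :=
  ∃ (f : Pt →ₗ[ℝ] ℝ) (a : ℝ), f ≠ 0 ∧ f p = a ∧ f q = a ∧ L = {x | a < f x}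

/-- `S` is a nice shape: a non-empty convex compact set such that every boundary
point has exactly one touching line and the boundary contains no non-trivial
straight line segment. -/
def NiceShape (S : Set Pt) : Prop :=
  S.Nonempty ∧ Convex ℝ S ∧ IsCompact S ∧
  (∀ p ∈ frontier S, ∃! l : Set Pt, IsLine l ∧ l ∩ S = {p}) ∧
  (∀ x ∈ frontier S, ∀ y ∈ frontier S, segment ℝ x y ⊆ frontier S → x = y)

/-- No four points of `A` lie on the boundary of a common `S`-range. -/
def NoFourOnBoundary (S A : Set Pt) : Prop :=
  ∀ T : Set Pt, IsRange S T →
    ∀ p₁ p₂ p₃ p₄ : Pt, p₁ ∈ A ∩ frontier T → p₂ ∈ A ∩ frontier T →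
      p₃ ∈ A ∩ frontier T → p₄ ∈ A ∩ frontier T →
      p₁ ≠ p₂ → p₁ ≠ p₃ → p₁ ≠ p₄ → p₂ ≠ p₃ → p₂ ≠ p₄ → p₃ ≠ p₄ → False

/-- `X` is in general position with respect to `S`: no two points on a vertical
line, no three points collinear, and no four points on the boundary of a common
`S`-range. -/
def GenPos (S : Set Pt) (X : Finset Pt) : Prop :=
  (∀ p ∈ X, ∀ q ∈ X, p ≠ q → p 0 ≠ q 0) ∧
  (∀ p ∈ X, ∀ q ∈ X, ∀ r ∈ X, p ≠ q → p ≠ r → q ≠ r →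
    ¬ Collinear ℝ ({p, q, r} : Set Pt)) ∧
  NoFourOnBoundary S ↑X

/-- The hyperedges of the `k`-uniform `S`-capturing hypergraph on `X`:
`k`-element subsets of `X` captured by some `S`-range. -/
def capturedSets (S : Set Pt) (X : Finset Pt) (k : ℕ) : Set (Set Pt) :=
  {Y | Y ⊆ ↑X ∧ Y.ncard = k ∧ ∃ T : Set Pt, IsRange S T ∧ ↑X ∩ T = Y}

/-- The `i`-sets of `X`: `i`-element subsets of `X` separable by a straight line,
i.e. captured by a closed halfplane.  `aᵢ` is the number of such sets. -/
def iSets (X : Finset Pt) (i : ℕ) : Set (Set Pt) :=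
  {Y | Y ⊆ ↑X ∧ Y.ncard = i ∧ ∃ H : Set Pt, IsClosedHalfplane H ∧ ↑X ∩ H = Y}

/-- `𝒜ᵢ`: closed halfplanes containing exactly `i` points of `X`, exactly two of
which lie on the boundary line. -/
def repHalfplanes (X : Finset Pt) (i : ℕ) : Set (Set Pt) :=
  {H | IsClosedHalfplane H ∧ ((↑X : Set Pt) ∩ H).ncard = i ∧
    ((↑X : Set Pt) ∩ frontier H).ncard = 2}

/-- `𝒮_pq`: the `S`-ranges having both `p` and `q` on their boundary. -/
def rangesThrough (S : Set Pt) (p q : Pt) : Set (Set Pt) :=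
  {T | IsRange S T ∧ p ∈ frontier T ∧ q ∈ frontier T}

/-- The ranges in `𝒮_pq` that come strictly after `S₁` (w.r.t. `≺`, i.e. inclusion
of the intersections with `L`) and have a point of `X` on their boundary that is
not on the boundary of `S₁`. -/
def nextCandidates (S : Set Pt) (p q : Pt) (L : Set Pt) (X : Finset Pt) (S₁ : Set Pt) :
    Set (Set Pt) :=
  {S₂ | S₂ ∈ rangesThrough S p q ∧ S₁ ∩ L ⊂ S₂ ∩ L ∧
    ((frontier S₂ \ frontier S₁) ∩ ↑X).Nonempty}

/-- `ℛ₁ᵏ`: Type I ranges, i.e. `S`-ranges containing exactly `k` points of `X`,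
exactly three of which are on the boundary. -/
def typeIRanges (S : Set Pt) (X : Finset Pt) (k : ℕ) : Set (Set Pt) :=
  {T | IsRange S T ∧ ((↑X : Set Pt) ∩ T).ncard = k ∧
    ((↑X : Set Pt) ∩ frontier T).ncard = 3}

/-- `ℛ(Y)`: the Type I representative ranges of `Y`. -/
def repRanges (S : Set Pt) (X : Finset Pt) (Y : Set Pt) : Set (Set Pt) :=
  {T | IsRange S T ∧ ↑X ∩ T = Y ∧ ((↑X : Set Pt) ∩ frontier T).ncard = 3}

/-- `ℰ₁ᵏ`: Type I hyperedges. -/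
def typeIEdges (S : Set Pt) (X : Finset Pt) (k : ℕ) : Set (Set Pt) :=
  {Y | Y ⊆ ↑X ∧ Y.ncard = k ∧ (repRanges S X Y).Nonempty}

/-- `ℰ₂ᵏ`: Type II hyperedges, captured by some `S`-range but by no `S`-range with
three points of `X` on its boundary. -/
def typeIIEdges (S : Set Pt) (X : Finset Pt) (k : ℕ) : Set (Set Pt) :=
  {Y | Y ∈ capturedSets S X k ∧ ¬ (repRanges S X Y).Nonempty}

open Classical in
/-- The number of faces `(B, Y)` of a face system `Q` on the ground set `R` with `d` boundary
elements and `k` interior elements. -/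
def faceCount {V : Type*} (Q : Finset V → Finset V → Finset V → Prop)
    (R : Finset V) (d k : ℕ) : ℕ :=
  ((R.powersetCard d ×ˢ R.powersetCard k).filter
    fun F => Disjoint F.1 F.2 ∧ Q R F.1 F.2).card

/-- Double counting of faces over the deletions of single elements. -/
theorem sum_faceCount_erase {V : Type*} [DecidableEq V]
    (Q : Finset V → Finset V → Finset V → Prop) (R : Finset V)
    (hdel : ∀ w ∈ R, ∀ B ⊆ R.erase w, ∀ Y ⊆ R.erase w, Disjoint B Y →
      (Q (R.erase w) B Y ↔ Q R B Y ∨ Q R B (insert w Y)))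
    (hins : ∀ w ∈ R, ∀ B ⊆ R.erase w, ∀ Y ⊆ R.erase w, Disjoint B Y →
      (Q R (insert w B) Y ↔ Q R B Y ∧ Q R B (insert w Y)))
    (d k : ℕ) :
    ∑ w ∈ R, (faceCount Q (R.erase w) d k : ℤ) =
      ((R.card : ℤ) - d - k) * faceCount Q R d k + (k + 1) * faceCount Q R d (k + 1)
        - (d + 1) * faceCount Q R (d + 1) k := by
  classical
  let P : ℕ → ℕ → Finset (Finset V × Finset V) := fun d k =>
    (R.powersetCard d ×ˢ R.powersetCard k).filter fun F => Disjoint F.1 F.2 ∧ Q R F.1 F.2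
  have hP : ∀ d k, faceCount Q R d k = (P d k).card := by
    intro d k
    simp only [faceCount, P]
    congr
  have hmem : ∀ d k F, F ∈ P d k ↔ F.1 ⊆ R ∧ F.1.card = d ∧ F.2 ⊆ R ∧ F.2.card = k ∧
      Disjoint F.1 F.2 ∧ Q R F.1 F.2 := by
    intro d k F
    simp only [P, Finset.mem_filter, Finset.mem_product, Finset.mem_powersetCard]
    tauto
  have hloc : ∀ w ∈ R, (faceCount Q (R.erase w) d k : ℤ) =
      ((P d k).filter fun F => w ∉ F.1 ∧ w ∉ F.2).card +
      ((P d (k + 1)).filter fun F => w ∈ F.2).card -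
      ((P (d + 1) k).filter fun F => w ∈ F.1).card := by
    intro w hw
    let U := ((R.erase w).powersetCard d ×ˢ (R.erase w).powersetCard k).filter
      fun F => Disjoint F.1 F.2
    have hU : ∀ F, F ∈ U ↔ F.1 ⊆ R.erase w ∧ F.1.card = d ∧ F.2 ⊆ R.erase w ∧ F.2.card = k ∧
        Disjoint F.1 F.2 := by
      intro F
      simp only [U, Finset.mem_filter, Finset.mem_product, Finset.mem_powersetCard]
      tauto
    have h1 : faceCount Q (R.erase w) d k =
        (U.filter fun F => Q R F.1 F.2 ∨ Q R F.1 (insert w F.2)).card := by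
      simp only [faceCount, U, Finset.filter_filter]
      congr 1
      ext F
      simp only [Finset.mem_filter, Finset.mem_product, Finset.mem_powersetCard]
      constructor
      · rintro ⟨⟨a, b⟩, c, e⟩
        exact ⟨⟨a, b⟩, c, (hdel w hw _ a.1 _ b.1 c).1 e⟩
      · rintro ⟨⟨a, b⟩, c, e⟩
        exact ⟨⟨a, b⟩, c, (hdel w hw _ a.1 _ b.1 c).2 e⟩
    have h2 : ((P d k).filter fun F => w ∉ F.1 ∧ w ∉ F.2) = U.filter fun F => Q R F.1 F.2 := by
      ext F
      simp only [Finset.mem_filter, hmem, hU, Finset.subset_erase]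
      tauto
    have h3 : ((P d (k + 1)).filter fun F => w ∈ F.2).card =
        (U.filter fun F => Q R F.1 (insert w F.2)).card := by
      symm
      refine Finset.card_bij (fun F _ => (F.1, insert w F.2)) ?_ ?_ ?_
      · intro F hF
        simp only [Finset.mem_filter, hU, Finset.subset_erase] at hF
        obtain ⟨⟨⟨a, a'⟩, b, ⟨c, c'⟩, e, f⟩, g⟩ := hF
        simp only [Finset.mem_filter, hmem, Finset.mem_insert_self, and_true]
        refine ⟨a, b, Finset.insert_subset hw c, by rw [Finset.card_insert_of_notMem c', e], ?_, g⟩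
        exact Finset.disjoint_insert_right.2 ⟨a', f⟩
      · intro F hF G hG h
        simp only [Finset.mem_filter, hU, Finset.subset_erase] at hF hG
        simp only [Prod.mk.injEq] at h
        refine Prod.ext h.1 ?_
        rw [← Finset.erase_insert hF.1.2.2.1.2, h.2, Finset.erase_insert hG.1.2.2.1.2]
      · intro F hF
        simp only [Finset.mem_filter, hmem] at hF
        obtain ⟨⟨a, b, c, e, f, g⟩, h⟩ := hF
        refine ⟨(F.1, F.2.erase w), ?_, ?_⟩
        · simp only [Finset.mem_filter, hU, Finset.subset_erase, Finset.insert_erase h]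
          refine ⟨⟨⟨a, fun hh => Finset.disjoint_left.1 f hh h⟩, b,
            ⟨(Finset.erase_subset _ _).trans c, by simp⟩, ?_, ?_⟩, g⟩
          · rw [Finset.card_erase_of_mem h, e]; rfl
          · exact f.mono_right (Finset.erase_subset _ _)
        · simp [Finset.insert_erase h]
    have h4 : ((P (d + 1) k).filter fun F => w ∈ F.1).card =
        (U.filter fun F => Q R F.1 F.2 ∧ Q R F.1 (insert w F.2)).card := by
      symm
      refine Finset.card_bij (fun F _ => (insert w F.1, F.2)) ?_ ?_ ?_
      · intro F hF
        simp only [Finset.mem_filter, hU] at hF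
        obtain ⟨⟨a, b, c, e, f⟩, g⟩ := hF
        have g' := (hins w hw _ a _ c f).2 g
        rw [Finset.subset_erase] at a c
        simp only [Finset.mem_filter, hmem, Finset.mem_insert_self, and_true]
        refine ⟨Finset.insert_subset hw a.1, by rw [Finset.card_insert_of_notMem a.2, b],
          c.1, e, ?_, g'⟩
        exact Finset.disjoint_insert_left.2 ⟨c.2, f⟩
      · intro F hF G hG h
        simp only [Finset.mem_filter, hU, Finset.subset_erase] at hF hG
        simp only [Prod.mk.injEq] at h
        refine Prod.ext ?_ h.2
        rw [← Finset.erase_insert hF.1.1.2, h.1, Finset.erase_insert hG.1.1.2]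
      · intro F hF
        simp only [Finset.mem_filter, hmem] at hF
        obtain ⟨⟨a, b, c, e, f, g⟩, h⟩ := hF
        have ha : F.1.erase w ⊆ R.erase w := Finset.erase_subset_erase _ a
        have hc : F.2 ⊆ R.erase w :=
          Finset.subset_erase.2 ⟨c, fun hh => Finset.disjoint_left.1 f h hh⟩
        have hf : Disjoint (F.1.erase w) F.2 := f.mono_left (Finset.erase_subset _ _)
        refine ⟨(F.1.erase w, F.2), ?_, ?_⟩
        · simp only [Finset.mem_filter, hU]
          refine ⟨⟨ha, ?_, hc, e, hf⟩, (hins w hw _ ha _ hc hf).1 ?_⟩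
          · rw [Finset.card_erase_of_mem h, b]; rfl
          · rwa [Finset.insert_erase h]
        · simp [Finset.insert_erase h]
    have h5 := Finset.card_union_add_card_inter (U.filter fun F => Q R F.1 F.2)
      (U.filter fun F => Q R F.1 (insert w F.2))
    rw [← Finset.filter_or, ← Finset.filter_and] at h5
    rw [h1, h2, h3, h4]
    have h6 := congrArg (Nat.cast : ℕ → ℤ) h5
    push_cast at h6
    linarith
  have dc : ∀ (A : Finset (Finset V × Finset V)) (p : V → Finset V × Finset V → Prop)
      [∀ w F, Decidable (p w F)] (m : ℤ),
      (∀ F ∈ A, ((R.filter fun w => p w F).card : ℤ) = m) →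
      ∑ w ∈ R, ((A.filter fun F => p w F).card : ℤ) = m * A.card := by
    intro A p _ m h
    have := Finset.sum_card_bipartiteAbove_eq_sum_card_bipartiteBelow (s := R) (t := A) p
    have h7 : ∑ w ∈ R, ((A.filter fun F => p w F).card : ℤ) =
        ∑ F ∈ A, ((R.filter fun w => p w F).card : ℤ) := by
      exact_mod_cast this
    rw [h7, Finset.sum_congr rfl h, Finset.sum_const, nsmul_eq_mul, mul_comm]
  rw [Finset.sum_congr rfl hloc, Finset.sum_sub_distrib, Finset.sum_add_distrib,
    dc (P d k) (fun w F => w ∉ F.1 ∧ w ∉ F.2) ((R.card : ℤ) - d - k),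
    dc (P d (k + 1)) (fun w F => w ∈ F.2) (k + 1),
    dc (P (d + 1) k) (fun w F => w ∈ F.1) (d + 1), hP, hP, hP]
  · intro F hF
    rw [hmem] at hF
    have : R.filter (fun w => w ∈ F.1) = F.1 := by
      ext w; simp only [Finset.mem_filter]; exact ⟨fun h => h.2, fun h => ⟨hF.1 h, h⟩⟩
    rw [this, hF.2.1]; push_cast; ring
  · intro F hF
    rw [hmem] at hF
    have : R.filter (fun w => w ∈ F.2) = F.2 := by
      ext w; simp only [Finset.mem_filter]; exact ⟨fun h => h.2, fun h => ⟨hF.2.2.1 h, h⟩⟩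
    rw [this, hF.2.2.2.1]; push_cast; ring
  · intro F hF
    rw [hmem] at hF
    have : R.filter (fun w => w ∉ F.1 ∧ w ∉ F.2) = R \ (F.1 ∪ F.2) := by
      ext w; simp
    rw [this, Finset.cast_card_sdiff (Finset.union_subset hF.1 hF.2.2.1),
      Finset.card_union_of_disjoint hF.2.2.2.2.1, hF.2.1, hF.2.2.2.1]
    push_cast; ring

/-- A sequence on `{0, …, n}` with vanishing fourth differences that vanishes at
`0`, `1`, `n - 1` and `n` is zero. -/
theorem eq_zero_of_fourth_difference_eq_zero {n : ℕ} (hn : 4 ≤ n) (g₀ g₁ g₂ g₃ : ℕ → ℚ)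
    (e₀ e₁ e₂ : ℚ)
    (h₀ : ∀ k, k + 1 ≤ n → g₀ k - g₀ (k + 1) = e₀ * g₁ k)
    (h₁ : ∀ k, k + 2 ≤ n → g₁ k - g₁ (k + 1) = e₁ * g₂ k)
    (h₂ : ∀ k, k + 3 ≤ n → g₂ k - g₂ (k + 1) = e₂ * g₃ k)
    (h₃ : ∀ k, k + 4 ≤ n → g₃ k - g₃ (k + 1) = 0)
    (z₀ : g₀ 0 = 0) (z₁ : g₀ 1 = 0) (z₂ : g₀ (n - 1) = 0) (z₃ : g₀ n = 0) :
    ∀ k ≤ n, g₀ k = 0 := by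
  have p₃ : ∀ k, k + 3 ≤ n → g₃ k = g₃ 0 := by
    intro k
    induction k with
    | zero => intro _; rfl
    | succ k ih =>
      intro hk
      have := h₃ k (by omega)
      have := ih (by omega)
      linarith
  have p₂ : ∀ k, k + 2 ≤ n → g₂ k = g₂ 0 - k * (e₂ * g₃ 0) := by
    intro k
    induction k with
    | zero => intro _; simp
    | succ k ih =>
      intro hk
      have a := h₂ k (by omega)
      have b := ih (by omega)
      rw [p₃ k (by omega)] at a
      push_cast
      linarith
  have p₁ : ∀ k, k + 1 ≤ n →
      e₀ * g₁ k = -k * (e₀ * e₁ * g₂ 0) + k * (k - 1) / 2 * (e₀ * e₁ * e₂ * g₃ 0) := by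
    intro k
    induction k with
    | zero =>
      intro _
      have := h₀ 0 (by omega)
      rw [z₀, z₁] at this
      simpa using this.symm
    | succ k ih =>
      intro hk
      have a := h₁ k (by omega)
      have b := ih (by omega)
      rw [p₂ k (by omega)] at a
      have a' := congrArg (e₀ * ·) a
      push_cast
      linear_combination b - a'
  have p₀ : ∀ k, k ≤ n → g₀ k = k * (k - 1) / 2 * (e₀ * e₁ * g₂ 0)
      - k * (k - 1) * (k - 2) / 6 * (e₀ * e₁ * e₂ * g₃ 0) := by
    intro k
    induction k with
    | zero => intro _; simp [z₀]
    | succ k ih =>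
      intro hk
      have a := h₀ k (by omega)
      have b := ih (by omega)
      rw [p₁ k (by omega)] at a
      push_cast
      linear_combination b - a
  obtain ⟨m, rfl⟩ : ∃ m, n = m + 4 := ⟨n - 4, by omega⟩
  have q₂ := p₀ (m + 3) (by omega)
  have q₃ := p₀ (m + 4) (by omega)
  have z₂' : g₀ (m + 3) = 0 := z₂
  rw [z₂'] at q₂
  rw [z₃] at q₃
  push_cast at q₂ q₃
  have hm : (0 : ℚ) ≤ m := Nat.cast_nonneg m
  set A := e₀ * e₁ * g₂ 0
  set B := e₀ * e₁ * e₂ * g₃ 0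
  have r₂ : A - (m + 1) / 3 * B = 0 := by
    have : ((m : ℚ) + 3) * (m + 2) / 2 * (A - (m + 1) / 3 * B) = 0 := by linear_combination -q₂
    exact (mul_eq_zero.1 this).resolve_left (by positivity)
  have r₃ : A - (m + 2) / 3 * B = 0 := by
    have : ((m : ℚ) + 4) * (m + 3) / 2 * (A - (m + 2) / 3 * B) = 0 := by linear_combination -q₃
    exact (mul_eq_zero.1 this).resolve_left (by positivity)
  have hB : B = 0 := by linear_combination 3 * r₂ - 3 * r₃
  have hA : A = 0 := by rw [hB] at r₂; linarith
  intro k hk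
  rw [p₀ k hk, hA, hB]
  ring

/-- Normalising by signed binomial coefficients turns the relation
`(N - k) δ(k) + (k + 1) δ(k + 1) = ε(k)` into a difference equation. -/
theorem signed_choose_difference {N k : ℕ} (hk : k + 1 ≤ N) (x y z c : ℚ)
    (h : ((N : ℚ) - k) * x + (k + 1) * y = c * z) :
    (-1) ^ k * x / (N.choose k) - (-1) ^ (k + 1) * y / (N.choose (k + 1)) =
      c / N * ((-1) ^ k * z / ((N - 1).choose k)) := by
  have e₁ : (N.choose (k + 1) : ℚ) * (k + 1) = N.choose k * (N - k) := by
    have := Nat.choose_succ_right_eq N k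
    have h2 := congrArg (Nat.cast : ℕ → ℚ) this
    push_cast [Nat.cast_sub (show k ≤ N by omega)] at h2
    exact h2
  have e₂ : ((N - 1).choose k : ℚ) * N = N.choose k * (N - k) := by
    obtain ⟨M, rfl⟩ : ∃ M, N = M + 1 := ⟨N - 1, by omega⟩
    have := Nat.choose_mul_succ_eq M k
    have h2 := congrArg (Nat.cast : ℕ → ℚ) this
    push_cast [Nat.cast_sub (show k ≤ M + 1 by omega)] at h2
    simpa using h2
  have n₁ : (N.choose k : ℚ) ≠ 0 := by
    exact_mod_cast (Nat.choose_pos (by omega)).ne'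
  have n₂ : (N.choose (k + 1) : ℚ) ≠ 0 := by
    exact_mod_cast (Nat.choose_pos hk).ne'
  have n₃ : ((N - 1).choose k : ℚ) ≠ 0 := by
    exact_mod_cast (Nat.choose_pos (by omega)).ne'
  have n₄ : (N : ℚ) ≠ 0 := by
    exact_mod_cast (show N ≠ 0 by omega)
  have n₅ : (N : ℚ) - k ≠ 0 := by
    have : (k : ℚ) + 1 ≤ N := by exact_mod_cast hk
    intro h; linarith
  have n₆ : (k : ℚ) + 1 ≠ 0 := by positivity
  have f₁ : (N.choose (k + 1) : ℚ) = N.choose k * (N - k) / (k + 1) := by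
    field_simp; linarith
  have f₂ : ((N - 1).choose k : ℚ) = N.choose k * (N - k) / N := by
    field_simp; linarith
  rw [f₁, f₂, pow_succ]
  field_simp
  linear_combination h

theorem eq_zero_of_deletion_relations (n : ℕ) (δ₀ δ₁ δ₂ δ₃ : ℕ → ℤ)
    (h₀ : ∀ k, k + 1 ≤ n → ((n : ℤ) - k) * δ₀ k + (k + 1) * δ₀ (k + 1) = δ₁ k)
    (h₁ : ∀ k, k + 2 ≤ n → ((n : ℤ) - 1 - k) * δ₁ k + (k + 1) * δ₁ (k + 1) = 2 * δ₂ k)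
    (h₂ : ∀ k, k + 3 ≤ n → ((n : ℤ) - 2 - k) * δ₂ k + (k + 1) * δ₂ (k + 1) = 3 * δ₃ k)
    (h₃ : ∀ k, k + 4 ≤ n → ((n : ℤ) - 3 - k) * δ₃ k + (k + 1) * δ₃ (k + 1) = 0)
    (z₀ : δ₀ 0 = 0) (z₁ : 1 ≤ n → δ₀ 1 = 0) (z₂ : δ₀ (n - 1) = 0) (z₃ : δ₀ n = 0) :
    (∀ k, k ≤ n → δ₀ k = 0) ∧ (∀ k, k + 1 ≤ n → δ₁ k = 0) ∧ (∀ k, k + 2 ≤ n → δ₂ k = 0) ∧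
      ∀ k, k + 3 ≤ n → δ₃ k = 0 := by
  have main : ∀ k, k ≤ n → δ₀ k = 0 := by
    rcases Nat.lt_or_ge n 4 with hn | hn
    · intro k hk
      have : k = 0 ∨ k = 1 ∨ k = n - 1 ∨ k = n := by omega
      rcases this with rfl | rfl | rfl | rfl
      exacts [z₀, z₁ hk, z₂, z₃]
    · have key := eq_zero_of_fourth_difference_eq_zero hn
        (fun k => (-1) ^ k * (δ₀ k : ℚ) / (n.choose k))
        (fun k => (-1) ^ k * (δ₁ k : ℚ) / ((n - 1).choose k))
        (fun k => (-1) ^ k * (δ₂ k : ℚ) / ((n - 2).choose k))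
        (fun k => (-1) ^ k * (δ₃ k : ℚ) / ((n - 3).choose k))
        (1 / n) (2 / (n - 1 : ℕ)) (3 / (n - 2 : ℕ))
        (fun k hk => ?_) (fun k hk => ?_) (fun k hk => ?_) (fun k hk => ?_) ?_ ?_ ?_ ?_
      · intro k hk
        have := key k hk
        simp only [div_eq_zero_iff, mul_eq_zero, pow_eq_zero_iff', neg_eq_zero, one_ne_zero,
          false_and, false_or, Int.cast_eq_zero, Nat.cast_eq_zero] at this
        rcases this with h | h
        · exact h
        · exact absurd h (Nat.choose_pos hk).ne'
      · refine signed_choose_difference hk _ _ _ 1 ?_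
        rw [one_mul]
        exact_mod_cast h₀ k hk
      · refine signed_choose_difference (N := n - 1) (by omega) _ _ _ 2 ?_
        rw [Nat.cast_sub (by omega)]
        exact_mod_cast h₁ k hk
      · refine signed_choose_difference (N := n - 2) (by omega) _ _ _ 3 ?_
        rw [Nat.cast_sub (by omega)]
        exact_mod_cast h₂ k hk
      · have := signed_choose_difference (N := n - 3) (k := k) (by omega) (δ₃ k) (δ₃ (k + 1)) 0 0
          (by rw [Nat.cast_sub (by omega), mul_zero]; exact_mod_cast h₃ k hk)
        rw [this]; simp
      · simp [z₀]
      · simp [z₁ (by omega)]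
      · simp [z₂]
      · simp [z₃]
  have m₁ : ∀ k, k + 1 ≤ n → δ₁ k = 0 := fun k hk => by
    have := h₀ k hk
    rw [main k (by omega), main (k + 1) hk] at this
    linarith
  have m₂ : ∀ k, k + 2 ≤ n → δ₂ k = 0 := fun k hk => by
    have := h₁ k hk
    rw [m₁ k (by omega), m₁ (k + 1) (by omega)] at this
    linarith
  refine ⟨main, m₁, m₂, fun k hk => ?_⟩
  have := h₂ k hk
  rw [m₂ k (by omega), m₂ (k + 1) (by omega)] at this
  linarith

/-- The face numbers of a face system are determined by its deletion relations together with
the numbers of faces with `0`, `1`, `n - 1` and `n` interior elements. -/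
theorem faceCount_eq_of_deletion {V : Type*} [DecidableEq V]
    (Q : Finset V → Finset V → Finset V → Prop) (β : Finset V → ℕ → ℤ) (X : Finset V)
    (hdel : ∀ R ⊆ X, ∀ w ∈ R, ∀ B ⊆ R.erase w, ∀ Y ⊆ R.erase w, Disjoint B Y →
      (Q (R.erase w) B Y ↔ Q R B Y ∨ Q R B (insert w Y)))
    (hins : ∀ R ⊆ X, ∀ w ∈ R, ∀ B ⊆ R.erase w, ∀ Y ⊆ R.erase w, Disjoint B Y →
      (Q R (insert w B) Y ↔ Q R B Y ∧ Q R B (insert w Y)))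
    (hfour : ∀ R ⊆ X, ∀ k, faceCount Q R 4 k = 0)
    (hβ : ∀ R ⊆ X, ∀ k : ℕ, ∑ z ∈ R, β (R.erase z) k =
      ((R.card : ℤ) - 1 - k) * β R k + ((k : ℤ) - 1) * β R (k + 1))
    (hzero : ∀ R ⊆ X, (faceCount Q R 0 0 : ℤ) = 1 - R.card - β R 0)
    (hone : ∀ R ⊆ X, 1 ≤ R.card → (faceCount Q R 0 1 : ℤ) = R.card - β R 1)
    (hpred : ∀ R ⊆ X, 1 ≤ R.card → (faceCount Q R 0 (R.card - 1) : ℤ) =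
      R.card * (R.card - 1) - β R (R.card - 1))
    (hcard : ∀ R ⊆ X, (faceCount Q R 0 R.card : ℤ) =
      R.card * (R.card - 1) + 1 - β R R.card)
    (R : Finset V) (hR : R ⊆ X) (k : ℕ) (hk : k ≤ R.card) :
    (faceCount Q R 0 k : ℤ) = (2 * k - 1) * R.card - k ^ 2 + 1 - β R k := by
  suffices H : ∀ n, ∀ R ⊆ X, R.card = n →
      (∀ k, k ≤ n → (faceCount Q R 0 k : ℤ) = (2 * k - 1) * n - k ^ 2 + 1 - β R k) ∧
      (∀ k, k + 1 ≤ n → (faceCount Q R 1 k : ℤ) =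
        3 * k * (2 * n - 1 - k) - β R k - 2 * β R (k + 1)) ∧
      (∀ k, k + 2 ≤ n → (faceCount Q R 2 k : ℤ) =
        3 * (2 * k + 1) * (n - 1) - 3 * k ^ 2 - 2 * β R (k + 1) - β R (k + 2)) ∧
      (∀ k, k + 3 ≤ n → (faceCount Q R 3 k : ℤ) =
        2 * (k + 1) * (n - 1) - k * (k + 1) - β R (k + 2)) from
    (H _ R hR rfl).1 k hk
  intro n
  induction n using Nat.strong_induction_on with
  | _ n ih =>
  intro R hR hn
  have ih' : ∀ z ∈ R, _ := fun z hz => ih (n - 1)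
    (by have := Finset.card_pos.2 ⟨z, hz⟩; omega) (R.erase z) ((Finset.erase_subset _ _).trans hR)
    (by rw [Finset.card_erase_of_mem hz, hn])
  have D := fun d k => sum_faceCount_erase Q R (hdel R hR) (hins R hR) d k
  have hn' : 1 ≤ n → ((n - 1 : ℕ) : ℤ) = n - 1 := fun h => by push_cast [h]; rfl
  have hb := hβ R hR
  simp only [hn] at D hb
  have key := eq_zero_of_deletion_relations n
    (fun k => (faceCount Q R 0 k : ℤ) - ((2 * k - 1) * n - k ^ 2 + 1 - β R k))
    (fun k => (faceCount Q R 1 k : ℤ) - (3 * k * (2 * n - 1 - k) - β R k - 2 * β R (k + 1)))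
    (fun k => (faceCount Q R 2 k : ℤ) -
      (3 * (2 * k + 1) * (n - 1) - 3 * k ^ 2 - 2 * β R (k + 1) - β R (k + 2)))
    (fun k => (faceCount Q R 3 k : ℤ) - (2 * (k + 1) * (n - 1) - k * (k + 1) - β R (k + 2)))
    (fun k hk => ?_) (fun k hk => ?_) (fun k hk => ?_) (fun k hk => ?_) ?_ (fun h => ?_) ?_ ?_
  · obtain ⟨k₀, k₁, k₂, k₃⟩ := key
    exact ⟨fun k hk => sub_eq_zero.1 (k₀ k hk), fun k hk => sub_eq_zero.1 (k₁ k hk),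
      fun k hk => sub_eq_zero.1 (k₂ k hk), fun k hk => sub_eq_zero.1 (k₃ k hk)⟩
  · have h := D 0 k
    rw [Finset.sum_congr rfl fun z hz => (ih' z hz).1 k (by omega), Finset.sum_sub_distrib, hb,
      Finset.sum_const, hn, nsmul_eq_mul, hn' (by omega)] at h
    push_cast at h ⊢
    linear_combination -h
  · have h := D 1 k
    rw [Finset.sum_congr rfl fun z hz => (ih' z hz).2.1 k (by omega), Finset.sum_sub_distrib,
      Finset.sum_sub_distrib, ← Finset.mul_sum R (fun z => β (R.erase z) (k + 1)) 2, hb, hb,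
      Finset.sum_const, hn, nsmul_eq_mul, hn' (by omega)] at h
    push_cast at h ⊢
    linear_combination -h
  · have h := D 2 k
    rw [Finset.sum_congr rfl fun z hz => (ih' z hz).2.2.1 k (by omega), Finset.sum_sub_distrib,
      Finset.sum_sub_distrib, ← Finset.mul_sum R (fun z => β (R.erase z) (k + 1)) 2, hb, hb,
      Finset.sum_const, hn, nsmul_eq_mul, hn' (by omega)] at h
    push_cast at h ⊢
    linear_combination -h
  · have h := D 3 k
    rw [Finset.sum_congr rfl fun z hz => (ih' z hz).2.2.2 k (by omega), Finset.sum_sub_distrib, hb,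
      Finset.sum_const, hn, nsmul_eq_mul, hn' (by omega), hfour R hR] at h
    push_cast at h ⊢
    linear_combination -h
  · have h := hzero R hR
    rw [hn] at h
    rw [h]; push_cast; ring
  · have h := hone R hR (by omega)
    rw [hn] at h
    rw [h]; push_cast; ring
  · rcases Nat.eq_zero_or_pos n with rfl | hpos
    · have h := hzero R hR
      rw [hn] at h
      simp only [Nat.zero_sub]
      rw [h]; push_cast; ring
    · have h := hpred R hR (by omega)
      rw [hn] at h
      rw [h, hn' hpos]; ring
  · have h := hcard R hR
    rw [hn] at h
    rw [h]; ring

open Classical in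
/-- The number of elements of `R` to the left of the pair `(p, q)`. -/
def leftCount {V : Type*} (left : V → V → V → Prop) (R : Finset V) (p q : V) : ℕ :=
  (R.filter fun z => left p q z).card

open Classical in
/-- The number of ordered pairs of distinct elements of `R` having fewer than `k` elements of `R`
on their left. -/
def fewLeftCount {V : Type*} (left : V → V → V → Prop) (R : Finset V) (k : ℕ) : ℕ :=
  (R.offDiag.filter fun e => leftCount left R e.1 e.2 < k).card

theorem sum_fewLeftCount_erase {V : Type*} [DecidableEq V] (left : V → V → V → Prop)
    (hp : ∀ p q, ¬ left p q p) (hq : ∀ p q, ¬ left p q q) (R : Finset V) (k : ℕ) :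
    ∑ z ∈ R, (fewLeftCount left (R.erase z) k : ℤ) =
      ((R.card : ℤ) - 2 - k) * fewLeftCount left R k + k * fewLeftCount left R (k + 1) := by
  classical
  let r : V → V × V → Prop := fun z e =>
    z ≠ e.1 ∧ z ≠ e.2 ∧ leftCount left (R.erase z) e.1 e.2 < k
  have h1 : ∀ z ∈ R, (fewLeftCount left (R.erase z) k : ℤ) =
      ((R.offDiag.filter fun e => r z e).card : ℤ) := by
    intro z hz
    unfold fewLeftCount
    congr 2
    ext e
    simp only [Finset.mem_filter, Finset.mem_offDiag, Finset.mem_erase, r, ne_eq]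
    grind
  have h2 : ∑ z ∈ R, ((R.offDiag.filter fun e => r z e).card : ℤ) =
      ∑ e ∈ R.offDiag, ((R.filter fun z => r z e).card : ℤ) := by
    exact_mod_cast Finset.sum_card_bipartiteAbove_eq_sum_card_bipartiteBelow
      (s := R) (t := R.offDiag) r
  have h3 : ∀ e ∈ R.offDiag, ((R.filter fun z => r z e).card : ℤ) =
      ((R.card : ℤ) - 2 - k) * (if leftCount left R e.1 e.2 < k then 1 else 0) +
        k * (if leftCount left R e.1 e.2 < k + 1 then 1 else 0) := by
    rintro ⟨p, q⟩ he
    rw [Finset.mem_offDiag] at he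
    obtain ⟨hpR, hqR, hpq⟩ := he
    simp only at hpR hqR hpq ⊢
    have hin : ∀ z ∈ R, left p q z → leftCount left (R.erase z) p q + 1 = leftCount left R p q := by
      intro z hz hl
      unfold leftCount
      rw [Finset.filter_erase]
      exact Finset.card_erase_add_one (Finset.mem_filter.2 ⟨hz, hl⟩)
    have hout : ∀ z, ¬ left p q z → leftCount left (R.erase z) p q = leftCount left R p q := by
      intro z hl
      unfold leftCount
      rw [Finset.filter_erase, Finset.erase_eq_of_notMem]
      simp [hl]
    rcases lt_trichotomy (leftCount left R p q) k with h | h | h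
    · have : (R.filter fun z => r z (p, q)) = (R.erase p).erase q := by
        ext z
        simp only [Finset.mem_filter, Finset.mem_erase, r]
        constructor
        · tauto
        · rintro ⟨a, b, c⟩
          refine ⟨c, b, a, ?_⟩
          by_cases hl : left p q z
          · have := hin z c hl; omega
          · rw [hout z hl]; exact h
      rw [this, Finset.card_erase_of_mem (Finset.mem_erase.2 ⟨hpq.symm, hqR⟩),
        Finset.card_erase_of_mem hpR, if_pos h, if_pos (by omega)]
      have : 1 < R.card := Finset.one_lt_card.2 ⟨p, hpR, q, hqR, hpq⟩
      omega
    · have : (R.filter fun z => r z (p, q)) = R.filter fun z => left p q z := by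
        ext z
        simp only [Finset.mem_filter, r]
        constructor
        · rintro ⟨a, b, c, e⟩
          refine ⟨a, ?_⟩
          by_contra hl
          rw [hout z hl] at e
          omega
        · rintro ⟨a, b⟩
          have := hin z a b
          refine ⟨a, ?_, ?_, by omega⟩
          · rintro rfl; exact hp _ _ b
          · rintro rfl; exact hq _ _ b
      have hc : (R.filter fun z => left p q z).card = k := h
      rw [this, if_neg (by omega), if_pos (by omega), hc]
      ring
    · have : (R.filter fun z => r z (p, q)) = ∅ := by
        ext z
        simp only [Finset.mem_filter, r, Finset.notMem_empty, iff_false]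
        rintro ⟨a, b, c, e⟩
        by_cases hl : left p q z
        · have := hin z a hl; omega
        · rw [hout z hl] at e; omega
      rw [this, if_neg (by omega), if_neg (by omega)]
      simp
  rw [Finset.sum_congr rfl h1, h2, Finset.sum_congr rfl h3, Finset.sum_add_distrib,
    ← Finset.mul_sum, ← Finset.mul_sum, Finset.sum_boole, Finset.sum_boole]
  rfl

/-- The number of pairs with at most `k - 2` points on their left, extended to `k = 0` so that the
deletion relation persists. -/
def shiftedLeftCount {V : Type*} (left : V → V → V → Prop) (R : Finset V) : ℕ → ℤ
  | 0 => -R.card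
  | k + 1 => fewLeftCount left R k

theorem sum_shiftedLeftCount_erase {V : Type*} [DecidableEq V] (left : V → V → V → Prop)
    (hp : ∀ p q, ¬ left p q p) (hq : ∀ p q, ¬ left p q q) (R : Finset V) (k : ℕ) :
    ∑ z ∈ R, shiftedLeftCount left (R.erase z) k =
      ((R.card : ℤ) - 1 - k) * shiftedLeftCount left R k +
        ((k : ℤ) - 1) * shiftedLeftCount left R (k + 1) := by
  cases k with
  | zero =>
    simp only [shiftedLeftCount]
    rw [Finset.sum_congr rfl fun z hz => show -((R.erase z).card : ℤ) = 1 - R.card by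
      rw [Finset.cast_card_erase_of_mem hz]; ring]
    simp [fewLeftCount]
    ring
  | succ k =>
    simp only [shiftedLeftCount]
    rw [sum_fewLeftCount_erase left hp hq]
    push_cast
    ring

open Classical in
theorem fewLeftCount_eq_sum {V : Type*} (left : V → V → V → Prop) (R : Finset V)
    (a : ℕ → ℕ) (k : ℕ)
    (ha : ∀ i < k, a (i + 1) = (R.offDiag.filter fun e => leftCount left R e.1 e.2 = i).card) :
    fewLeftCount left R k = ∑ i ∈ Finset.Icc 1 k, a i := by
  induction k with
  | zero => simp [fewLeftCount]
  | succ k ih =>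
    rw [Finset.sum_Icc_succ_top (by omega), ← ih fun i hi => ha i (by omega), ha k (by omega)]
    unfold fewLeftCount
    rw [← Finset.card_union_of_disjoint, ← Finset.filter_or]
    · congr 1
      ext e
      simp only [Finset.mem_filter, and_congr_right_iff]
      intro _
      omega
    · rw [Finset.disjoint_filter]
      intros
      omega

/-- The determinant of two vectors of the plane. -/
def crs (x y : Pt) : ℝ := x 0 * y 1 - x 1 * y 0

/-- `z` lies strictly to the left of the oriented line from `p` to `q`. -/
def IsLeft (p q z : Pt) : Prop := 0 < crs (q - p) (z - p)

/-- No three points of `R` are collinear. -/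
def NoThreeCollinear (R : Finset Pt) : Prop :=
  ∀ p ∈ R, ∀ q ∈ R, ∀ z ∈ R, p ≠ q → p ≠ z → q ≠ z → crs (q - p) (z - p) ≠ 0

theorem sq_add_sq_pos_of_ne_zero {d : Pt} (hd : d ≠ 0) : 0 < d 0 ^ 2 + d 1 ^ 2 := by
  by_contra h
  have h1 : d 0 = 0 := by nlinarith [sq_nonneg (d 0), sq_nonneg (d 1)]
  have h2 : d 1 = 0 := by nlinarith [sq_nonneg (d 0), sq_nonneg (d 1)]
  apply hd
  ext i
  fin_cases i <;> simp [h1, h2]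

theorem exists_eq_smul_of_crs_eq_zero {d v : Pt} (hd : d ≠ 0) (h : crs d v = 0) :
    ∃ τ : ℝ, v = τ • d := by
  have hne := (sq_add_sq_pos_of_ne_zero hd).ne'
  refine ⟨(v 0 * d 0 + v 1 * d 1) / (d 0 ^ 2 + d 1 ^ 2), ?_⟩
  unfold crs at h
  ext i
  rw [PiLp.smul_apply, smul_eq_mul, div_mul_eq_mul_div, eq_div_iff hne]
  fin_cases i
  · simp only [Fin.zero_eta]; linear_combination -d 1 * h
  · simp only [Fin.mk_one]; linear_combination d 0 * h

theorem GenPos.noThreeCollinear {S : Set Pt} {X : Finset Pt} (hX : GenPos S X) :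
    NoThreeCollinear X := by
  intro p hp q hq z hz hpq hpz hqz h
  refine hX.2.1 p hp q hq z hz hpq hpz hqz ?_
  rw [collinear_iff_of_mem (p₀ := p) (by simp)]
  obtain ⟨τ, hτ⟩ := exists_eq_smul_of_crs_eq_zero (sub_ne_zero.2 hpq.symm) h
  refine ⟨q - p, ?_⟩
  simp only [mem_insert_iff, mem_singleton_iff, forall_eq_or_imp, forall_eq, vadd_eq_add]
  exact ⟨⟨0, by simp⟩, ⟨1, by simp⟩, τ, by rw [← hτ]; simp⟩

/-- `Y` is cut out of `R` by a closed halfplane. -/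
def HalfplaneCapt (R Y : Finset Pt) : Prop :=
  ∃ (f : Pt →ₗ[ℝ] ℝ) (a : ℝ), f ≠ 0 ∧ ∀ x ∈ R, f x ≤ a ↔ x ∈ Y

theorem isLeft_left (p q : Pt) : ¬ IsLeft p q p := by simp [IsLeft, crs]

theorem isLeft_right (p q : Pt) : ¬ IsLeft p q q := by simp [IsLeft, crs, mul_comm]

/-- The linear functional with coefficients `α` and `β`. -/
def coordFunctional (α β : ℝ) : Pt →ₗ[ℝ] ℝ :=
  α • (EuclideanSpace.proj (0 : Fin 2) : Pt →L[ℝ] ℝ).toLinearMap +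
    β • (EuclideanSpace.proj (1 : Fin 2) : Pt →L[ℝ] ℝ).toLinearMap

@[simp] theorem coordFunctional_apply (α β : ℝ) (x : Pt) :
    coordFunctional α β x = α * x 0 + β * x 1 := by
  simp [coordFunctional]

theorem exists_eq_coordFunctional (f : Pt →ₗ[ℝ] ℝ) : ∃ α β, f = coordFunctional α β := by
  refine ⟨f (EuclideanSpace.single 0 1), f (EuclideanSpace.single 1 1), ?_⟩
  ext x
  have : x = x 0 • EuclideanSpace.single 0 1 + x 1 • EuclideanSpace.single 1 1 := by
    ext i; fin_cases i <;> simp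
  conv_lhs => rw [this]
  simp [mul_comm]

/-- The set consisting of `p` and the points to the left of `pq` is cut out by a halfplane not
containing `q`. -/
theorem halfplaneCapt_left {R : Finset Pt} (hR : NoThreeCollinear R) {p q : Pt} (hp : p ∈ R)
    (hq : q ∈ R) (hpq : p ≠ q) (Y : Finset Pt) (hpY : p ∈ Y) (hqY : q ∉ Y)
    (hY : ∀ z ∈ R, z ≠ p → z ≠ q → (z ∈ Y ↔ IsLeft p q z)) : HalfplaneCapt R Y := by
  set d := q - p with hd
  have hdpos : 0 < d 0 ^ 2 + d 1 ^ 2 := sq_add_sq_pos_of_ne_zero (sub_ne_zero.2 hpq.symm)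
  let h : ℝ → Pt → ℝ := fun ε z => -crs d (z - p) +
    ε * (d 0 * (z - p) 0 + d 1 * (z - p) 1 - (d 0 ^ 2 + d 1 ^ 2) / 2)
  have hcont : ∀ z, Filter.Tendsto (fun ε => h ε z) (nhdsWithin 0 (Ioi 0))
      (nhds (-crs d (z - p))) := by
    intro z
    have : Continuous fun ε => h ε z := by fun_prop
    have h0 := this.tendsto 0
    simp only [h, zero_mul, add_zero] at h0
    exact h0.mono_left nhdsWithin_le_nhds
  have hev : ∀ᶠ ε in nhdsWithin (0 : ℝ) (Ioi 0), ∀ z ∈ R, h ε z ≤ 0 ↔ z ∈ Y := by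
    rw [Filter.eventually_all_finset]
    intro z hz
    by_cases hzp : z = p
    · subst hzp
      filter_upwards [self_mem_nhdsWithin] with ε hε
      have : 0 < ε := hε
      simp only [h, hpY, iff_true, crs]
      simp
      positivity
    by_cases hzq : z = q
    · subst hzq
      filter_upwards [self_mem_nhdsWithin] with ε hε
      have : 0 < ε := hε
      simp only [h, hqY, iff_false, not_le, ← hd, crs]
      nlinarith
    have hne : crs d (z - p) ≠ 0 := hR p hp q hq z hz hpq (Ne.symm hzp) (Ne.symm hzq)
    rw [hY z hz hzp hzq]
    unfold IsLeft
    rcases lt_or_gt_of_ne hne with hlt | hgt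
    · filter_upwards [(hcont z).eventually (lt_mem_nhds (show 0 < -crs d (z - p) by linarith))]
        with ε hε
      rw [← hd]
      constructor <;> intro <;> linarith
    · filter_upwards [(hcont z).eventually (gt_mem_nhds (show -crs d (z - p) < 0 by linarith))]
        with ε hε
      rw [← hd]
      constructor <;> intro <;> linarith
  obtain ⟨ε, hε, hε0⟩ := (hev.and self_mem_nhdsWithin).exists
  refine ⟨coordFunctional (d 1 + ε * d 0) (-d 0 + ε * d 1),
    (d 1 + ε * d 0) * p 0 + (-d 0 + ε * d 1) * p 1 + ε * ((d 0 ^ 2 + d 1 ^ 2) / 2), ?_, ?_⟩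
  · intro h0
    have h1 : coordFunctional (d 1 + ε * d 0) (-d 0 + ε * d 1) d = 0 := by rw [h0]; rfl
    rw [coordFunctional_apply] at h1
    have : 0 < ε := hε0
    nlinarith
  · intro x hx
    rw [← hε x hx]
    simp only [h, crs, coordFunctional_apply, PiLp.sub_apply]
    constructor <;> intro <;> linarith

/-- A subset cut out by a halfplane is determined by one of its inner common tangents. -/
theorem exists_tangent_of_halfplaneCapt {R : Finset Pt} (hR : NoThreeCollinear R) {Y : Finset Pt}
    (hY : HalfplaneCapt R Y) (hYR : Y ⊆ R) (hne : Y.Nonempty) (hne' : Y ≠ R) :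
    ∃ p ∈ Y, ∃ q ∈ R, q ∉ Y ∧ ∀ z ∈ R, z ≠ p → z ≠ q → (z ∈ Y ↔ IsLeft p q z) := by
  classical
  obtain ⟨f, a, hf, hfa⟩ := hY
  obtain ⟨α, β, rfl⟩ := exists_eq_coordFunctional f
  set f := coordFunctional α β
  set g := coordFunctional (-β) α
  have hN : 0 < α ^ 2 + β ^ 2 := by
    by_contra h
    have h1 : α = 0 := by nlinarith [sq_nonneg α, sq_nonneg β]
    have h2 : β = 0 := by nlinarith [sq_nonneg α, sq_nonneg β]
    apply hf
    ext x
    simp [f, h1, h2]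
  have hcrs : ∀ u v, crs u v * (α ^ 2 + β ^ 2) = f u * g v - g u * f v := by
    intro u v
    simp only [crs, f, g, coordFunctional_apply]
    ring
  have hsep : ∀ y ∈ Y, ∀ z ∈ R \ Y, 0 < f (z - y) := by
    intro y hy z hz
    rw [Finset.mem_sdiff] at hz
    have h1 := (hfa y (hYR hy)).2 hy
    have h2 : ¬ f z ≤ a := fun h => hz.2 ((hfa z hz.1).1 h)
    rw [map_sub]
    linarith
  have hne2 : (R \ Y).Nonempty := by
    rw [Finset.sdiff_nonempty]
    exact fun h => hne' (Finset.Subset.antisymm hYR h)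
  obtain ⟨⟨p, q⟩, hpq, hmax⟩ := Finset.exists_max_image (Y ×ˢ (R \ Y))
    (fun e => g (e.2 - e.1) / f (e.2 - e.1)) (hne.product hne2)
  rw [Finset.mem_product] at hpq
  obtain ⟨hp, hq⟩ := hpq
  simp only at hp hq hmax
  have hqR := (Finset.mem_sdiff.1 hq).1
  have hqY := (Finset.mem_sdiff.1 hq).2
  have hpq : p ≠ q := fun h => hqY (h ▸ hp)
  have hle : ∀ y ∈ Y, ∀ z ∈ R \ Y, crs (q - p) (z - y) ≤ 0 := by
    intro y hy z hz
    have h1 := hmax (y, z) (Finset.mem_product.2 ⟨hy, hz⟩)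
    rw [div_le_div_iff₀ (hsep y hy z hz) (hsep p hp q hq)] at h1
    simp only at h1
    have h2 := hcrs (q - p) (z - y)
    by_contra hcon
    have h3 : 0 < crs (q - p) (z - y) * (α ^ 2 + β ^ 2) := mul_pos (not_le.1 hcon) hN
    nlinarith
  refine ⟨p, hp, q, hqR, hqY, fun z hz hzp hzq => ?_⟩
  have hnz := hR p (hYR hp) q hqR z hz hpq (Ne.symm hzp) (Ne.symm hzq)
  unfold IsLeft
  constructor
  · intro hzY
    have h1 := hle z hzY q hq
    have h2 : crs (q - p) (z - p) = -crs (q - p) (q - z) := by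
      simp only [crs, PiLp.sub_apply]; ring
    exact lt_of_le_of_ne (by rw [h2]; linarith) (Ne.symm hnz)
  · intro hl
    by_contra hzY
    have h1 := hle p hp z (Finset.mem_sdiff.2 ⟨hz, hzY⟩)
    linarith

open Classical in
theorem card_halfplaneCapt {R : Finset Pt} (hR : NoThreeCollinear R) {k : ℕ}
    (hk : k + 1 < R.card) :
    ((R.powersetCard (k + 1)).filter fun Y => HalfplaneCapt R Y).card =
      (R.offDiag.filter fun e => leftCount IsLeft R e.1 e.2 = k).card := by
  symm
  have hmemY : ∀ p ∈ R, ∀ q ∈ R, p ≠ q → ∀ z ∈ R, z ≠ p → z ≠ q →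
      (z ∈ insert p (R.filter fun z => IsLeft p q z) ↔ IsLeft p q z) := by
    intro p _ q _ _ z hz hzp _
    simp [hz, hzp]
  have hq : ∀ p q, p ≠ q → q ∉ insert p (R.filter fun z => IsLeft p q z) := by
    intro p q hpq
    simp [hpq.symm, isLeft_right]
  refine Finset.card_bij (fun e _ => insert e.1 (R.filter fun z => IsLeft e.1 e.2 z)) ?_ ?_ ?_
  · rintro ⟨p, q⟩ he
    simp only [Finset.mem_filter, Finset.mem_offDiag] at he
    obtain ⟨⟨hp, hqR, hpq⟩, hc⟩ := he
    simp only [Finset.mem_filter, Finset.mem_powersetCard]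
    refine ⟨⟨Finset.insert_subset hp (Finset.filter_subset _ _), ?_⟩, ?_⟩
    · rw [Finset.card_insert_of_notMem (by simp [isLeft_left])]
      rw [← hc]; rfl
    · exact halfplaneCapt_left hR hp hqR hpq _ (Finset.mem_insert_self _ _) (hq p q hpq)
        (hmemY p hp q hqR hpq)
  · have hsign : ∀ p ∈ R, ∀ q ∈ R, p ≠ q → ∀ z ∈ R,
        (z ∈ insert p (R.filter fun z => IsLeft p q z) → 0 ≤ crs (q - p) (z - p)) ∧
        (z ∉ insert p (R.filter fun z => IsLeft p q z) → crs (q - p) (z - p) ≤ 0) := by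
      intro p _ q _ _ z hz
      simp only [Finset.mem_insert, Finset.mem_filter, hz, true_and]
      refine ⟨?_, fun h => not_lt.1 fun h' => h (Or.inr h')⟩
      rintro (rfl | h)
      · simp [crs]
      · exact h.le
    rintro ⟨p, q⟩ he ⟨p', q'⟩ he' hYY
    simp only [Finset.mem_filter, Finset.mem_offDiag] at he he' hYY
    obtain ⟨⟨hp, hqR, hpq⟩, -⟩ := he
    obtain ⟨⟨hp', hqR', hpq'⟩, -⟩ := he'
    have s := hsign p hp q hqR hpq
    have s' := hsign p' hp' q' hqR' hpq'
    have hqY := hq p q hpq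
    have hqY' := hq p' q' hpq'
    have hpY : p ∈ insert p (R.filter fun z => IsLeft p q z) := Finset.mem_insert_self _ _
    have hpY' : p' ∈ insert p' (R.filter fun z => IsLeft p' q' z) := Finset.mem_insert_self _ _
    rw [← hYY] at s' hqY' hpY'
    have i1 := (s q' hqR').2 hqY'
    have i2 := (s p' hp').1 hpY'
    have i3 := (s' q hqR).2 hqY
    have i4 := (s' p hp).1 hpY
    have e1 : crs (q - p) (q' - p) - crs (q - p) (p' - p) =
        -(crs (q' - p') (q - p') - crs (q' - p') (p - p')) := by
      simp only [crs, PiLp.sub_apply]; ring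
    have z1 : crs (q - p) (q' - p) = 0 := by linarith
    have z2 : crs (q - p) (p' - p) = 0 := by linarith
    have hpp : p ≠ q' := by rintro rfl; exact hqY' hpY
    have hqp : q ≠ p' := by rintro rfl; exact hqY hpY'
    have hqq : q = q' := by
      by_contra h
      exact hR p hp q hqR q' hqR' hpq hpp h z1
    have hpp' : p = p' := by
      by_contra h
      exact hR p hp q hqR p' hp' hpq h hqp z2
    rw [hpp', hqq]
  · intro Y hY
    simp only [Finset.mem_filter, Finset.mem_powersetCard] at hY
    obtain ⟨⟨hYR, hYc⟩, hY⟩ := hY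
    obtain ⟨p, hp, q, hqR, hqY, h⟩ := exists_tangent_of_halfplaneCapt hR hY hYR
      (Finset.card_pos.1 (by omega)) (by rintro rfl; omega)
    have hpq : p ≠ q := fun h => hqY (h ▸ hp)
    have hYeq : insert p (R.filter fun z => IsLeft p q z) = Y := by
      ext z
      by_cases hzp : z = p
      · subst hzp; simp [hp]
      by_cases hzq : z = q
      · subst hzq; simp [hqY, hzp, isLeft_right]
      by_cases hz : z ∈ R
      · rw [h z hz hzp hzq]; simp [hzp, hz]
      · simp only [Finset.mem_insert, hzp, Finset.mem_filter, hz]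
        simp only [false_and, or_self, false_iff]
        exact fun h => hz (hYR h)
    refine ⟨(p, q), ?_, hYeq⟩
    simp only [Finset.mem_filter, Finset.mem_offDiag]
    refine ⟨⟨hYR hp, hqR, hpq⟩, ?_⟩
    have : (insert p (R.filter fun z => IsLeft p q z)).card = k + 1 := by rw [hYeq, hYc]
    rw [Finset.card_insert_of_notMem (by simp [isLeft_left])] at this
    unfold leftCount
    omega

theorem NoThreeCollinear.mono {R X : Finset Pt} (hX : NoThreeCollinear X) (h : R ⊆ X) :
    NoThreeCollinear R :=
  fun p hp q hq z hz => hX p (h hp) q (h hq) z (h hz)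

open Classical in
theorem leftCount_add_two_le {R : Finset Pt} {e : Pt × Pt} (he : e ∈ R.offDiag) :
    leftCount IsLeft R e.1 e.2 + 2 ≤ R.card := by
  rw [Finset.mem_offDiag] at he
  obtain ⟨hp, hq, hpq⟩ := he
  have h1 : R.filter (fun z => IsLeft e.1 e.2 z) ⊆ (R.erase e.1).erase e.2 := by
    intro z hz
    rw [Finset.mem_filter] at hz
    simp only [Finset.mem_erase]
    refine ⟨?_, ?_, hz.1⟩
    · intro h; rw [h] at hz; exact isLeft_right _ _ hz.2
    · intro h; rw [h] at hz; exact isLeft_left _ _ hz.2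
  have h2 := Finset.card_le_card h1
  rw [Finset.card_erase_of_mem (Finset.mem_erase.2 ⟨hpq.symm, hq⟩),
    Finset.card_erase_of_mem hp] at h2
  have : 1 < R.card := Finset.one_lt_card.2 ⟨e.1, hp, e.2, hq, hpq⟩
  unfold leftCount
  omega

theorem shiftedLeftCount_card (R : Finset Pt) :
    shiftedLeftCount IsLeft R R.card = R.card * (R.card - 1) := by
  classical
  obtain h | ⟨m, hm⟩ : R.card = 0 ∨ ∃ m, R.card = m + 1 := by
    cases h : R.card with
    | zero => simp
    | succ m => exact Or.inr ⟨m, rfl⟩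
  · rw [h]; simp [shiftedLeftCount, h]
  · rw [hm]
    simp only [shiftedLeftCount, fewLeftCount]
    rw [Finset.filter_true_of_mem, Finset.offDiag_card, hm]
    · push_cast [Nat.cast_sub (show m + 1 ≤ (m + 1) * (m + 1) by nlinarith)]
      ring
    · intro e he
      have := leftCount_add_two_le he
      omega

open Classical in
/-- The number of subsets with `R.card - 1` elements that are cut out by a halfplane. -/
theorem card_halfplaneCapt_pred {R : Finset Pt} (hR : NoThreeCollinear R) (h : 2 ≤ R.card) :
    (((R.powersetCard (R.card - 1)).filter fun Y => HalfplaneCapt R Y).card : ℤ) =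
      R.card * (R.card - 1) - shiftedLeftCount IsLeft R (R.card - 1) := by
  obtain ⟨m, hm⟩ : ∃ m, R.card = m + 2 := ⟨R.card - 2, by omega⟩
  have h1 := shiftedLeftCount_card R
  rw [← h1, hm]
  simp only [Nat.add_succ_sub_one, shiftedLeftCount]
  rw [card_halfplaneCapt hR (by omega)]
  unfold fewLeftCount
  rw [eq_sub_iff_add_eq]
  norm_cast
  rw [← Finset.card_union_of_disjoint, ← Finset.filter_or]
  · congr 1
    ext e
    simp only [Finset.mem_filter, and_congr_right_iff]
    intro _
    omega
  · rw [Finset.disjoint_filter]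
    intros
    omega

open Classical in
theorem shiftedLeftCount_eq_sum {R : Finset Pt} (hR : NoThreeCollinear R) {k : ℕ} (hk : 1 ≤ k)
    (hkR : k ≤ R.card) : shiftedLeftCount IsLeft R k = ∑ i ∈ Finset.Icc 1 (k - 1),
      (((R.powersetCard i).filter fun Y => HalfplaneCapt R Y).card : ℤ) := by
  obtain ⟨m, rfl⟩ : ∃ m, k = m + 1 := ⟨k - 1, by omega⟩
  simp only [shiftedLeftCount, Nat.add_sub_cancel]
  rw [fewLeftCount_eq_sum IsLeft R
    (fun i => ((R.powersetCard i).filter fun Y => HalfplaneCapt R Y).card) m]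
  · push_cast; rfl
  · intro i hi
    exact card_halfplaneCapt hR (by omega)

open Classical in
theorem ncard_setOf_subset_eq_card (X : Finset Pt) (k : ℕ) (P : Set Pt → Prop) :
    {Y : Set Pt | Y ⊆ ↑X ∧ Y.ncard = k ∧ P Y}.ncard =
      ((X.powersetCard k).filter fun Y : Finset Pt => P ↑Y).card := by
  rw [← Set.ncard_coe_finset, ← Set.ncard_image_of_injective _ Finset.coe_injective]
  congr 1
  ext Y
  simp only [mem_ofPred_eq, Finset.coe_filter, Finset.mem_powersetCard, mem_image]
  constructor
  · rintro ⟨h1, h2, h3⟩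
    have hfin := X.finite_toSet.subset h1
    refine ⟨hfin.toFinset, ⟨⟨?_, ?_⟩, ?_⟩, hfin.coe_toFinset⟩
    · rw [← Finset.coe_subset, hfin.coe_toFinset]; exact h1
    · rw [← Set.ncard_eq_toFinset_card _ hfin, h2]
    · rwa [hfin.coe_toFinset]
  · rintro ⟨Z, ⟨⟨h1, h2⟩, h3⟩, rfl⟩
    exact ⟨by exact_mod_cast h1, by rw [Set.ncard_coe_finset, h2], h3⟩

open Classical in
theorem ncard_iSets (X : Finset Pt) (i : ℕ) :
    (iSets X i).ncard = ((X.powersetCard i).filter fun Y => HalfplaneCapt X Y).card := by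
  unfold iSets
  rw [ncard_setOf_subset_eq_card]
  congr 1
  refine Finset.filter_congr fun Y hY => ?_
  rw [Finset.mem_powersetCard] at hY
  constructor
  · rintro ⟨H, ⟨f, a, hf, rfl⟩, h⟩
    refine ⟨f, a, hf, fun x hx => ?_⟩
    have := Set.ext_iff.1 h x
    simpa [hx] using this
  · rintro ⟨f, a, hf, h⟩
    refine ⟨_, ⟨f, a, hf, rfl⟩, ?_⟩
    ext x
    simp only [mem_inter_iff, Finset.mem_coe, mem_ofPred_eq]
    exact ⟨fun hx => (h x hx.1).1 hx.2, fun hx => ⟨hY.1 hx, (h x (hY.1 hx)).2 hx⟩⟩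

theorem NiceShape.frontier_eq {S : Set Pt} (hS : NiceShape S) : frontier S = S \ interior S :=
  hS.2.2.1.isClosed.frontier_eq

theorem NiceShape.interior_nonempty {S : Set Pt} (hS : NiceShape S) : (interior S).Nonempty := by
  by_contra h
  rw [not_nonempty_iff_eq_empty] at h
  have hfr : frontier S = S := by rw [hS.frontier_eq, h, sdiff_empty]
  obtain ⟨⟨p, hp⟩, hconv, -, hline, hseg⟩ := hS
  rw [hfr] at hline hseg
  have hsub : ∀ y ∈ S, y = p := fun y hy => hseg y hy p hp (hconv.segment_subset hy hp)
  obtain ⟨l, -, huniq⟩ := hline p hp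
  have hl : ∀ f : Pt →ₗ[ℝ] ℝ, f ≠ 0 → {x | f x = f p} = l := by
    intro f hf
    refine huniq _ ⟨⟨f, f p, hf, rfl⟩, ?_⟩
    ext y
    constructor
    · rintro ⟨-, hy⟩
      exact hsub y hy
    · rintro rfl
      exact ⟨rfl, hp⟩
  have h0 : coordFunctional 1 0 ≠ 0 := by
    intro h0
    have : coordFunctional 1 0 (EuclideanSpace.single 0 1) = 0 := by rw [h0]; rfl
    simp at this
  have h1 : coordFunctional 0 1 ≠ 0 := by
    intro h0
    have : coordFunctional 0 1 (EuclideanSpace.single 1 1) = 0 := by rw [h0]; rfl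
    simp at this
  have heq := (hl _ h0).trans (hl _ h1).symm
  have : p + EuclideanSpace.single 1 1 ∈ {x | coordFunctional 1 0 x = coordFunctional 1 0 p} := by
    simp
  rw [heq] at this
  simp at this

theorem NiceShape.strictConvex {S : Set Pt} (hS : NiceShape S) : StrictConvex ℝ S := by
  have hfr := hS.frontier_eq
  obtain ⟨-, hconv, -, -, hseg⟩ := hS
  rw [hfr] at hseg
  intro x hx y hy hxy a b ha hb hab
  by_contra hz
  apply hxy
  have key : segment ℝ x y ⊆ S \ interior S := by
    intro w hw
    refine ⟨hconv.segment_subset hx hy hw, fun hwi => hz ?_⟩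
    obtain ⟨s, t, hs, ht, hst, rfl⟩ := hw
    rcases lt_trichotomy t b with h | rfl | h
    · have hs' : 0 < s := by linarith
      have := hconv.combo_interior_self_mem_interior hwi hy (a := a / s) (b := (b - t) / s)
        (by positivity) (div_nonneg (by linarith) hs) (by field_simp; linarith)
      convert this using 1
      rw [smul_add, smul_smul, smul_smul, add_assoc, ← add_smul]
      congr 2
      · field_simp
      · field_simp
        have : s = 1 - t := by linarith
        have : a = 1 - b := by linarith
        subst_vars
        ring
    · have : a = s := by linarith
      rwa [this]
    · have ht' : 0 < t := by linarith
      have := hconv.combo_interior_self_mem_interior hwi hx (a := b / t) (b := (a - s) / t)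
        (by positivity) (div_nonneg (by linarith) ht) (by field_simp; linarith)
      convert this using 1
      rw [smul_add, smul_smul, smul_smul, add_right_comm, ← add_smul]
      congr 2
      · field_simp
        have : t = 1 - s := by linarith
        have : b = 1 - a := by linarith
        subst_vars
        ring
      · field_simp
  exact hseg x (key (left_mem_segment ℝ x y)) y (key (right_mem_segment ℝ x y)) key

/-- The supporting line of a nice shape at a boundary point is unique, hence every direction
pointing strictly to the inner side of a supporting line enters the shape. -/
theorem NiceShape.exists_add_smul_mem {S : Set Pt} (hS : NiceShape S) {f : Pt →ₗ[ℝ] ℝ}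
    (hf : f ≠ 0) {s : Pt} (hs : s ∈ S) (hmax : ∀ y ∈ S, f y ≤ f s) {v : Pt} (hv : f v < 0) :
    ∃ ε > (0 : ℝ), ∀ t : ℝ, 0 < t → t ≤ ε → s + t • v ∈ S := by
  have hsc := hS.strictConvex
  have hconv := hS.2.1
  obtain ⟨m, hm⟩ := hS.interior_nonempty
  by_cases hex : ∃ ε > (0 : ℝ), s + ε • v ∈ interior S
  · obtain ⟨ε, hε, h⟩ := hex
    refine ⟨ε, hε, fun t ht hte => ?_⟩
    have := hconv (interior_subset h) hs (a := t / ε) (b := 1 - t / ε) (by positivity)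
      (by rw [sub_nonneg, div_le_one hε]; exact hte) (by ring)
    convert this using 1
    rw [smul_add, smul_smul, div_mul_cancel₀ _ hε.ne', sub_smul, one_smul]
    abel
  exfalso
  push Not at hex
  have hray : Convex ℝ ((fun ε : ℝ => s + ε • v) '' Ioi 0) := by
    have : (fun ε : ℝ => s + ε • v) = fun ε : ℝ => (AffineMap.lineMap s (s + v) : ℝ →ᵃ[ℝ] Pt) ε := by
      ext ε; simp [AffineMap.lineMap_apply, add_comm]
    rw [this]
    exact (convex_Ioi 0).affine_image _
  obtain ⟨g, u, hg1, hg2⟩ := geometric_hahn_banach_open hconv.interior isOpen_interior hray (by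
    rw [Set.disjoint_right]
    rintro _ ⟨ε, hε, rfl⟩
    exact hex ε hε)
  have hg2' : ∀ ε : ℝ, 0 < ε → u ≤ g s + ε * g v := by
    intro ε hε
    have := hg2 _ ⟨ε, hε, rfl⟩
    simpa using this
  have hgs : u ≤ g s := by
    refine le_of_forall_pos_le_add fun δ hδ => ?_
    have h1 := hg2' (δ / (|g v| + 1)) (by positivity)
    have h2 : δ / (|g v| + 1) * g v ≤ δ := by
      rw [div_mul_eq_mul_div, div_le_iff₀ (by positivity)]
      nlinarith [le_abs_self (g v)]
    linarith
  have hgS : ∀ y ∈ S, g y ≤ u := by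
    intro y hy
    have : S ⊆ closure (interior S) := by
      rw [hconv.closure_interior_eq_closure_of_nonempty_interior ⟨m, hm⟩]
      exact subset_closure
    exact closure_minimal (fun z hz => (hg1 z hz).le)
      (isClosed_le g.continuous continuous_const) (this hy)
  have hgsu : g s = u := le_antisymm (hgS s hs) hgs
  have hgv : 0 ≤ g v := by
    have := hg2' 1 one_pos
    linarith
  have hgm : g m < g s := hgsu ▸ hg1 m hm
  have hfi : ∀ z ∈ interior S, f z < f s := by
    intro z hz
    refine lt_of_le_of_ne (hmax z (interior_subset hz)) fun heq => ?_
    obtain ⟨w, hw⟩ : ∃ w, 0 < f w := ⟨-v, by simpa using hv⟩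
    have hcont : Filter.Tendsto (fun t : ℝ => z + t • w) (nhdsWithin 0 (Ioi 0)) (nhds z) := by
      have : Continuous fun t : ℝ => z + t • w := by fun_prop
      have h0 := this.tendsto 0
      simp only [zero_smul, add_zero] at h0
      exact h0.mono_left nhdsWithin_le_nhds
    obtain ⟨t, ht, ht0⟩ := ((hcont.eventually (isOpen_interior.mem_nhds hz)).and
      self_mem_nhdsWithin).exists
    have := hmax _ (interior_subset ht)
    simp only [map_add, map_smul, smul_eq_mul] at this
    have : 0 < t * f w := mul_pos ht0 hw
    linarith
  have hsfr : s ∈ frontier S := by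
    rw [hS.frontier_eq]
    exact ⟨hs, fun h => (hfi s h).ne rfl⟩
  obtain ⟨l, -, huniq⟩ := hS.2.2.2.1 s hsfr
  have hl : ∀ h : Pt →ₗ[ℝ] ℝ, h ≠ 0 → (∀ z ∈ interior S, h z < h s) → {x | h x = h s} = l := by
    intro h hh hlt
    refine huniq _ ⟨⟨h, h s, hh, rfl⟩, ?_⟩
    ext y
    constructor
    · rintro ⟨hy, hyS⟩
      by_contra hne
      have := hlt _ (hsc hyS hs hne (by norm_num : (0 : ℝ) < 1 / 2)
        (by norm_num : (0 : ℝ) < 1 / 2) (by norm_num))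
      simp only [map_add, map_smul, smul_eq_mul] at this
      have hy' : h y = h s := hy
      linarith
    · rintro rfl
      exact ⟨rfl, hs⟩
  have hgne : (g : Pt →ₗ[ℝ] ℝ) ≠ 0 := by
    intro h0
    have e1 : g m = 0 := LinearMap.congr_fun h0 m
    have e2 : g s = 0 := LinearMap.congr_fun h0 s
    linarith
  have heq := (hl f hf hfi).trans (hl g hgne fun z hz => hgsu ▸ hg1 z hz).symm
  have hfm := hfi m hm
  have hmem : s + (v - (f v / f (m - s)) • (m - s)) ∈ {x | f x = f s} := by
    have : f (m - s) ≠ 0 := by rw [map_sub]; linarith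
    change f _ = f s
    rw [map_add, map_sub f v, map_smul, smul_eq_mul, div_mul_cancel₀ _ this]
    ring
  rw [heq] at hmem
  have h5 : g v = f v / f (m - s) * g (m - s) := by
    have : g (s + (v - (f v / f (m - s)) • (m - s))) = g s := hmem
    rw [map_add, map_sub, map_smul, smul_eq_mul] at this
    linarith
  have h6 : f v / f (m - s) * g (m - s) < 0 :=
    mul_neg_of_pos_of_neg (div_pos_of_neg_of_neg hv (by rw [map_sub]; linarith))
      (by rw [map_sub]; linarith)
  linarith

theorem isRange_iff {S T : Set Pt} :
    IsRange S T ↔ ∃ (r : ℝ) (u : Pt), 0 < r ∧ T = {x | r • x + u ∈ S} := by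
  have key : ∀ (c : ℝ) (v : Pt), 0 < c →
      (fun x => c • x + v) '' S = {x | c⁻¹ • x + (-(c⁻¹ • v)) ∈ S} := by
    intro c v hc
    ext x
    constructor
    · rintro ⟨y, hy, rfl⟩
      have : c⁻¹ • (c • y + v) + -(c⁻¹ • v) = y := by
        rw [smul_add, smul_smul, inv_mul_cancel₀ hc.ne', one_smul]; abel
      rw [← this] at hy
      exact hy
    · intro hx
      refine ⟨_, hx, ?_⟩
      simp only [smul_add, smul_neg, smul_smul, mul_inv_cancel₀ hc.ne', one_smul]
      abel
  constructor
  · rintro ⟨c, v, hc, rfl⟩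
    exact ⟨c⁻¹, _, inv_pos.2 hc, key c v hc⟩
  · rintro ⟨r, u, hr, rfl⟩
    refine ⟨r⁻¹, -(r⁻¹ • u), inv_pos.2 hr, ?_⟩
    rw [key _ _ (inv_pos.2 hr)]
    simp [smul_smul, hr.ne']

theorem frontier_setOf_smul_add_mem (S : Set Pt) {r : ℝ} (hr : 0 < r) (u : Pt) :
    frontier {x | r • x + u ∈ S} = {x | r • x + u ∈ frontier S} :=
  (((Homeomorph.smulOfNeZero r hr.ne').trans (Homeomorph.addRight u)).preimage_frontier S).symm

/-- The map `x ↦ r x + u` sends both `p` and `q` to the boundary of `S`; equivalently, the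
corresponding homothetic copy of `S` has `p` and `q` on its boundary. -/
structure Through (S : Set Pt) (p q : Pt) (r : ℝ) (u : Pt) : Prop where
  pos : 0 < r
  left : r • p + u ∈ frontier S
  right : r • q + u ∈ frontier S

theorem StrictConvex.mem_interior_of_combo {S : Set Pt} (hS : StrictConvex ℝ S) {x y z : Pt}
    (hx : x ∈ S) (hy : y ∈ S) (hxy : x ≠ y) {t : ℝ} (h0 : 0 < t) (h1 : t < 1)
    (hz : z = (1 - t) • x + t • y) : z ∈ interior S :=
  hz ▸ hS hx hy hxy (by linarith) h0 (by ring)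

theorem crs_add_right (x y z : Pt) : crs x (y + z) = crs x y + crs x z := by
  simp only [crs, PiLp.add_apply]; ring

theorem crs_sub_right (x y z : Pt) : crs x (y - z) = crs x y - crs x z := by
  simp only [crs, PiLp.sub_apply]; ring

theorem crs_smul_right (x y : Pt) (c : ℝ) : crs x (c • y) = c * crs x y := by
  simp only [crs, PiLp.smul_apply, smul_eq_mul]; ring

theorem crs_self (x : Pt) : crs x x = 0 := by
  simp only [crs]; ring

theorem exists_eq_smul_add_smul {d e : Pt} (h : crs d e ≠ 0) (v : Pt) :
    ∃ σ : ℝ, v = σ • d + (crs d v / crs d e) • e := by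
  have hd : d ≠ 0 := by rintro rfl; simp [crs] at h
  obtain ⟨σ, hσ⟩ := exists_eq_smul_of_crs_eq_zero (d := d) (v := v - (crs d v / crs d e) • e) hd
    (by rw [crs_sub_right, crs_smul_right, div_mul_cancel₀ _ h, sub_self])
  exact ⟨σ, by rw [← hσ]; abel⟩

theorem sigma_pos_of_chords {S : Set Pt} (hS : StrictConvex ℝ S) {a a' d : Pt} {r' K σ : ℝ}
    (hr' : 0 < r') (hK : 0 < K) (ha : a ∈ S) (ha' : a' ∉ interior S) (hb' : a' + r' • d ∈ S)
    (hw : a' + (r' * σ) • d + (r' * K) • (a' - a) ∈ S) (hd : crs d (a' - a) ≠ 0) : 0 < σ := by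
  by_contra hσ
  push Not at hσ
  apply ha'
  set w := a' + (r' * σ) • d + (r' * K) • (a' - a) with hwdef
  set H := 1 + r' * K with hH
  have hrK : 0 < r' * K := mul_pos hr' hK
  have hH1 : 1 < H := by linarith
  have hne : a ≠ w := by
    intro h
    have h1 : crs d a = crs d w := by rw [← h]
    rw [hwdef, crs_add_right, crs_add_right, crs_smul_right, crs_smul_right, crs_self] at h1
    have h2 : (1 + r' * K) * crs d (a' - a) = 0 := by
      rw [crs_sub_right] at h1 ⊢
      linarith
    rcases mul_eq_zero.1 h2 with h3 | h3
    · linarith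
    · exact hd h3
  have hn : (r' * K / H) • a + (1 / H) • w ∈ interior S :=
    hS ha hw hne (by positivity) (by positivity) (by field_simp; rw [hH]; ring)
  have hHσ : 0 < H - σ := by linarith
  have := hS.convex.combo_interior_self_mem_interior hn hb' (a := H / (H - σ)) (b := -σ / (H - σ))
    (by positivity) (div_nonneg (by linarith) hHσ.le) (by field_simp; ring)
  convert this using 1
  rw [hwdef]
  match_scalars <;> field_simp <;> rw [hH] <;> ring

/-- Monotonicity in the pencil of homothetic copies through `p` and `q`. -/
theorem mem_interior_of_pencil {S : Set Pt} (hS : StrictConvex ℝ S) (hc : IsClosed S)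
    {p q : Pt} (hpq : p ≠ q) {r r' : ℝ} {u u' : Pt} (h : Through S p q r u)
    (h' : Through S p q r' u') {x : Pt}
    (hx : 0 < crs (q - p) (x - p) *
      (crs (q - p) (r' • p + u') - crs (q - p) (r • p + u)))
    (hw : r' • x + u' ∈ S) : r • x + u ∈ interior S := by
  obtain ⟨hr, ha, hb⟩ := h
  obtain ⟨hr', ha', hb'⟩ := h'
  rw [hc.frontier_eq] at ha hb ha' hb'
  set d := q - p with hd
  rw [← crs_sub_right] at hx
  have hde : crs d (r' • p + u' - (r • p + u)) ≠ 0 := by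
    intro h0; rw [h0, mul_zero] at hx; exact lt_irrefl _ hx
  obtain ⟨σ, hσ⟩ := exists_eq_smul_add_smul hde (x - p)
  set K := crs d (x - p) / crs d (r' • p + u' - (r • p + u)) with hKdef
  have hK : 0 < K := by
    rw [hKdef, ← mul_div_mul_right _ _ hde]
    exact div_pos hx (mul_self_pos.2 hde)
  have hxp : x = p + σ • d + K • (r' • p + u' - (r • p + u)) := by
    rw [add_assoc, ← hσ]; abel
  have hq : q = p + d := by rw [hd]; abel
  clear_value d K
  subst hq
  have σpos : 0 < σ := by
    refine sigma_pos_of_chords hS hr' hK ha.1 ha'.2 (d := d) ?_ ?_ hde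
    · convert hb'.1 using 1; module
    · convert hw using 1; rw [hxp]; module
  have σlt : 0 < 1 + (r' - r) * K - σ := by
    refine sigma_pos_of_chords hS hr' hK hb.1 hb'.2 (d := -d) ?_ ?_ ?_
    · convert ha'.1 using 1; module
    · convert hw using 1; rw [hxp]; module
    · intro h0
      apply hde
      have e1 : r' • (p + d) + u' - (r • (p + d) + u) =
        (r' • p + u' - (r • p + u)) + (r' - r) • d := by module
      rw [e1, crs_add_right, crs_smul_right] at h0
      simp only [crs, PiLp.neg_apply] at h0 ⊢
      linarith
  set D := 1 + (r' - r) * K with hD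
  have hDpos : 0 < D := by linarith
  have hH : 0 < 1 + r' * K := by positivity
  have hn : (1 - σ / D) • (r • p + u) + (σ / D) • (r • (p + d) + u) ∈ interior S := by
    refine hS ha.1 hb.1 ?_ ?_ (by positivity) (by ring)
    · intro h0
      apply hpq
      rw [smul_add, add_right_comm, left_eq_add, smul_eq_zero] at h0
      rcases h0 with h0 | h0
      · exact absurd h0 hr.ne'
      · rw [h0, add_zero]
    · rw [sub_pos, div_lt_one hDpos]; linarith
  have := hS.convex.combo_interior_self_mem_interior hn hw (a := D / (1 + r' * K))
    (b := r * K / (1 + r' * K)) (by positivity) (by positivity) (by field_simp; rw [hD]; ring)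
  convert this using 1
  rw [hxp]
  match_scalars <;> field_simp <;> (try rw [hD]) <;> ring

/-- Two copies through `p` and `q` whose chords lie on a common line coincide. -/
theorem Through.unique {S : Set Pt} (hS : StrictConvex ℝ S) (hc : IsClosed S)
    {p q : Pt} (hpq : p ≠ q) {r r' : ℝ} {u u' : Pt} (h : Through S p q r u)
    (h' : Through S p q r' u')
    (heq : crs (q - p) (r • p + u) = crs (q - p) (r' • p + u')) : r = r' ∧ u = u' := by
  obtain ⟨hr, ha, hb⟩ := h
  obtain ⟨hr', ha', hb'⟩ := h'
  rw [hc.frontier_eq] at ha hb ha' hb'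
  obtain ⟨d, rfl⟩ : ∃ d, q = p + d := ⟨q - p, by abel⟩
  have hd : d ≠ 0 := fun h => hpq (by rw [h, add_zero])
  rw [add_sub_cancel_left] at heq
  have heq' : crs d (r' • p + u' - (r • p + u)) = 0 := by rw [crs_sub_right, heq, sub_self]
  obtain ⟨τ, hτ⟩ := exists_eq_smul_of_crs_eq_zero hd heq'
  have ea' : r' • p + u' = r • p + u + τ • d := by rw [← hτ]; abel
  have eb : r • (p + d) + u = r • p + u + r • d := by module
  have eb' : r' • (p + d) + u' = r • p + u + (τ + r') • d := by
    rw [add_smul, ← add_assoc, ← ea']; module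
  have ea : r • p + u = r • p + u + (0 : ℝ) • d := by simp
  rw [ea'] at ha'
  rw [eb] at hb
  rw [eb'] at hb'
  rw [ea] at ha
  have key : ∀ s t w : ℝ, s < t → t < w → r • p + u + s • d ∈ S → r • p + u + w • d ∈ S →
      r • p + u + t • d ∈ interior S := by
    intro s t w hst htw hs hw
    have hsw : 0 < w - s := by linarith
    refine hS.mem_interior_of_combo hs hw ?_ (t := (t - s) / (w - s)) ?_ ?_ ?_
    · intro h0
      have : (w - s) • d = 0 := by
        rw [sub_smul, sub_eq_zero]; exact (add_left_cancel h0).symm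
      rcases smul_eq_zero.1 this with h1 | h1
      · linarith
      · exact hd h1
    · exact div_pos (by linarith) hsw
    · rw [div_lt_one hsw]; linarith
    · match_scalars <;> field_simp <;> ring
  have hτ0 : τ = 0 := by
    rcases lt_trichotomy τ 0 with h | h | h
    · exact absurd (key τ 0 r h hr ha'.1 hb.1) ha.2
    · exact h
    · exact absurd (key 0 τ (τ + r') h (by linarith) ha.1 hb'.1) ha'.2
  subst hτ0
  rw [zero_add] at hb'
  have hrr : r = r' := by
    rcases lt_trichotomy r r' with h | h | h
    · exact absurd (key 0 r r' hr h ha.1 hb'.1) hb.2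
    · exact h
    · exact absurd (key 0 r' r hr' h ha.1 hb.1) hb'.2
  subst hrr
  refine ⟨rfl, ?_⟩
  rw [zero_smul, add_zero] at ea'
  exact (add_left_cancel ea').symm

/-- On the line through `p` and `q`, all copies through `p` and `q` agree. -/
theorem Through.mem_iff_of_line {S : Set Pt} (hS : StrictConvex ℝ S) (hc : IsClosed S)
    {p q : Pt} (hpq : p ≠ q) {r : ℝ} {u : Pt} (h : Through S p q r u) (τ : ℝ) :
    (r • (p + τ • (q - p)) + u ∈ S ↔ 0 ≤ τ ∧ τ ≤ 1) ∧
      (r • (p + τ • (q - p)) + u ∈ interior S ↔ 0 < τ ∧ τ < 1) := by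
  obtain ⟨hr, ha, hb⟩ := h
  rw [hc.frontier_eq] at ha hb
  have hne : r • p + u ≠ r • q + u := by
    intro h
    exact hpq (smul_right_injective _ hr.ne' (add_right_cancel h))
  set x := r • (p + τ • (q - p)) + u with hx
  have hcombo : x = (1 - τ) • (r • p + u) + τ • (r • q + u) := by rw [hx]; module
  have hlt0 : τ < 0 → x ∉ S := by
    intro hτ hxS
    apply ha.2
    have h1 : 0 < 1 - τ := by linarith
    refine hS.mem_interior_of_combo hxS hb.1 ?_ (t := -τ / (1 - τ))
      (div_pos (by linarith) h1) (by rw [div_lt_one h1]; linarith) ?_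
    · intro h0
      rw [hcombo] at h0
      have : (1 - τ) • (r • p + u - (r • q + u)) = 0 := by
        rw [smul_sub, sub_eq_zero, ← add_right_cancel_iff (a := τ • (r • q + u)), h0]; module
      rcases smul_eq_zero.1 this with h2 | h2
      · linarith
      · exact hne (sub_eq_zero.1 h2)
    · rw [hcombo]; match_scalars <;> field_simp <;> ring
  have hgt1 : 1 < τ → x ∉ S := by
    intro hτ hxS
    apply hb.2
    refine hS.mem_interior_of_combo ha.1 hxS ?_ (t := 1 / τ)
      (by positivity) (by rw [div_lt_one (by linarith)]; linarith) ?_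
    · intro h0
      rw [hcombo] at h0
      have : τ • (r • p + u - (r • q + u)) = 0 := by
        rw [smul_sub, sub_eq_zero, ← add_left_cancel_iff (a := (1 - τ) • (r • p + u)), ← h0]; module
      rcases smul_eq_zero.1 this with h2 | h2
      · linarith
      · exact hne (sub_eq_zero.1 h2)
    · rw [hcombo]; match_scalars <;> field_simp <;> ring
  have hS' : x ∈ S → 0 ≤ τ ∧ τ ≤ 1 := fun h =>
    ⟨not_lt.1 fun h' => hlt0 h' h, not_lt.1 fun h' => hgt1 h' h⟩
  refine ⟨⟨hS', fun h => ?_⟩, ⟨fun h => ?_, fun h => ?_⟩⟩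
  · rw [hcombo]
    exact hS.convex ha.1 hb.1 (by linarith) h.1 (by ring)
  · obtain ⟨h0, h1⟩ := hS' (interior_subset h)
    refine ⟨lt_of_le_of_ne h0 ?_, lt_of_le_of_ne h1 ?_⟩
    · rintro rfl; apply ha.2; rw [hcombo] at h; simpa using h
    · rintro rfl; apply hb.2; rw [hcombo] at h; simpa using h
  · exact hS.mem_interior_of_combo ha.1 hb.1 hne h.1 h.2 hcombo

theorem convex_setOf_smul_add_mem {S : Set Pt} (hS : Convex ℝ S) (r : ℝ) (u : Pt) :
    Convex ℝ {x | r • x + u ∈ S} := by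
  intro x hx y hy a b ha hb hab
  have := hS hx hy ha hb hab
  change r • (a • x + b • y) + u ∈ S
  convert this using 1
  have hb' : b = 1 - a := by linarith
  rw [hb']
  module

theorem isCompact_setOf_smul_add_mem {S : Set Pt} (hS : IsCompact S) {r : ℝ} (hr : 0 < r)
    (u : Pt) : IsCompact {x | r • x + u ∈ S} :=
  (((Homeomorph.smulOfNeZero r hr.ne').trans (Homeomorph.addRight u)).isCompact_preimage).2 hS

/-- The gauge, based at an interior point, of a homothetic copy of a convex body. -/
theorem exists_gauge {S : Set Pt} (hS : Convex ℝ S) (hc : IsCompact S) {r : ℝ} (hr : 0 < r)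
    {u m : Pt} (hm : r • m + u ∈ interior S) :
    ∃ g : Pt → ℝ, Continuous g ∧ (∀ c, 0 ≤ c → ∀ v, g (c • v) = c * g v) ∧
      (∀ v, v ≠ 0 → 0 < g v) ∧ (∀ v, g v ≤ 1 ↔ r • (m + v) + u ∈ S) ∧
      (∀ v, g v = 1 ↔ r • (m + v) + u ∈ frontier S) := by
  set K : Set Pt := {v | r • v + (r • m + u) ∈ S} with hK
  have hKc : IsCompact K := isCompact_setOf_smul_add_mem hc hr _
  have hKconv : Convex ℝ K := convex_setOf_smul_add_mem hS _ _
  have hK0 : K ∈ nhds 0 := by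
    have hcont : Continuous fun v : Pt => r • v + (r • m + u) := by fun_prop
    have : (fun v : Pt => r • v + (r • m + u)) ⁻¹' interior S ∈ nhds 0 :=
      (isOpen_interior.preimage hcont).mem_nhds (by simpa using hm)
    exact Filter.mem_of_superset this fun v hv => interior_subset (s := S) hv
  have e : ∀ v, r • (m + v) + u = r • v + (r • m + u) := fun v => by module
  refine ⟨gauge K, continuous_gauge hKconv hK0, ?_, ?_, ?_, ?_⟩
  · intro c hc v
    rw [gauge_smul_of_nonneg hc, smul_eq_mul]
  · intro v hv
    exact (gauge_pos (absorbent_nhds_zero hK0) ((NormedSpace.isVonNBounded_iff ℝ).2 hKc.isBounded)).2 hv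
  · intro v
    rw [gauge_le_one_iff_mem_closure hKconv hK0, hKc.isClosed.closure_eq, e]
    rfl
  · intro v
    rw [gauge_eq_one_iff_mem_frontier hKconv hK0, e, hK, frontier_setOf_smul_add_mem S hr]
    rfl

/-- Two overlapping homothetic copies, neither containing the other, have two common boundary
points. -/
theorem exists_two_common_boundary_points {S : Set Pt} (hS : Convex ℝ S) (hc : IsCompact S)
    {r₀ r₁ : ℝ} (hr₀ : 0 < r₀) (hr₁ : 0 < r₁) {u₀ u₁ m x y : Pt}
    (hm₀ : r₀ • m + u₀ ∈ interior S) (hm₁ : r₁ • m + u₁ ∈ interior S)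
    (hx₁ : r₁ • x + u₁ ∈ S) (hx₀ : r₀ • x + u₀ ∉ S)
    (hy₀ : r₀ • y + u₀ ∈ S) (hy₁ : r₁ • y + u₁ ∉ S) :
    ∃ p q, p ≠ q ∧ Through S p q r₀ u₀ ∧ Through S p q r₁ u₁ := by
  obtain ⟨g₀, c₀, h₀, pos₀, le₀, eq₀⟩ := exists_gauge hS hc hr₀ hm₀
  obtain ⟨g₁, c₁, h₁, pos₁, le₁, eq₁⟩ := exists_gauge hS hc hr₁ hm₁
  let F : Pt → ℝ := fun v => g₀ v - g₁ v
  have hF : Continuous F := c₀.sub c₁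
  have hFh : ∀ c, 0 ≤ c → ∀ v, F (c • v) = c * F v := by
    intro c hc v
    simp only [F, h₀ c hc, h₁ c hc]; ring
  have hxF : 0 < F (x - m) := by
    have a := (le₁ (x - m)).2 (by rwa [add_sub_cancel])
    have b : ¬ g₀ (x - m) ≤ 1 := fun h => hx₀ (by simpa using (le₀ (x - m)).1 h)
    simp only [F]; linarith
  have hyF : F (y - m) < 0 := by
    have a := (le₀ (y - m)).2 (by rwa [add_sub_cancel])
    have b : ¬ g₁ (y - m) ≤ 1 := fun h => hy₁ (by simpa using (le₁ (y - m)).1 h)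
    simp only [F]; linarith
  have hF0 : F 0 = 0 := by
    have := hFh 0 le_rfl 0
    simpa using this
  have hzero : ∀ U : Set Pt, IsPreconnected U → x - m ∈ U → y - m ∈ U → ∃ z ∈ U, F z = 0 := by
    intro U hU hx hy
    obtain ⟨z, hz, hz0⟩ := hU.intermediate_value hy hx hF.continuousOn
      (⟨hyF.le, hxF.le⟩ : (0 : ℝ) ∈ Icc (F (y - m)) (F (x - m)))
    exact ⟨z, hz, hz0⟩
  have hrank : 1 < Module.rank ℝ Pt := by
    rw [← Module.finrank_eq_rank, finrank_euclideanSpace_fin]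
    norm_num
  obtain ⟨z₁, hz₁, hFz₁⟩ := hzero {0}ᶜ (isConnected_compl_singleton_of_one_lt_rank hrank 0).2
    (fun h => by rw [mem_singleton_iff] at h; rw [h, hF0] at hxF; exact lt_irrefl _ hxF)
    (fun h => by rw [mem_singleton_iff] at h; rw [h, hF0] at hyF; exact lt_irrefl _ hyF)
  have hz₁ne : z₁ ≠ 0 := hz₁
  set U : Set Pt := {v | ∀ c : ℝ, 0 ≤ c → v ≠ c • z₁} with hU
  have hUmem : ∀ v, F v ≠ 0 → v ∈ U := by
    intro v hv c hc h
    apply hv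
    rw [h, hFh c hc, hFz₁, mul_zero]
  have hnegmem : -z₁ ∈ U := by
    intro c hc h
    have : (c + 1) • z₁ = 0 := by rw [add_smul, ← h, one_smul]; abel
    rcases smul_eq_zero.1 this with h1 | h1
    · linarith
    · exact hz₁ne h1
  have hstar : StarConvex ℝ (-z₁) U := by
    intro v hv a b ha hb hab c hc h
    rcases hb.eq_or_lt with rfl | hb'
    · have : a = 1 := by linarith
      subst this
      exact hnegmem c hc (by simpa using h)
    · refine hv ((c + a) / b) (by positivity) ?_
      have : b • v = (c + a) • z₁ := by
        rw [add_smul, ← h]; module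
      rw [div_eq_inv_mul, mul_smul, ← this, smul_smul, inv_mul_cancel₀ hb'.ne', one_smul]
  obtain ⟨z₂, hz₂, hFz₂⟩ := hzero U (hstar.isPathConnected hnegmem).isConnected.2
    (hUmem _ hxF.ne') (hUmem _ hyF.ne)
  have hz₂ne : z₂ ≠ 0 := fun h => hz₂ 0 le_rfl (by rw [h, zero_smul])
  have hfr : ∀ z, z ≠ 0 → F z = 0 → r₀ • (m + (g₀ z)⁻¹ • z) + u₀ ∈ frontier S ∧
      r₁ • (m + (g₀ z)⁻¹ • z) + u₁ ∈ frontier S := by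
    intro z hz hFz
    have hp := pos₀ z hz
    have hg : g₀ z = g₁ z := by simpa [F, sub_eq_zero] using hFz
    constructor
    · rw [← eq₀, h₀ _ (by positivity), inv_mul_cancel₀ hp.ne']
    · rw [← eq₁, h₁ _ (by positivity), ← hg, inv_mul_cancel₀ hp.ne']
  have f₁ := hfr z₁ hz₁ne hFz₁
  have f₂ := hfr z₂ hz₂ne hFz₂
  refine ⟨_, _, ?_, ⟨hr₀, f₁.1, f₂.1⟩, ⟨hr₁, f₁.2, f₂.2⟩⟩
  intro h
  have h2 := add_left_cancel h
  have hp₁ := pos₀ z₁ hz₁ne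
  have hp₂ := pos₀ z₂ hz₂ne
  refine hz₂ (g₀ z₂ * (g₀ z₁)⁻¹) (by positivity) ?_
  rw [mul_smul, h2, smul_smul, mul_inv_cancel₀ hp₂.ne', one_smul]

/-- How far one can move from `o` in direction `v` within `S`. -/
def reach (S : Set Pt) (v o : Pt) : ℝ := sSup {s : ℝ | o + s • v ∈ S}

theorem bddAbove_reach {S : Set Pt} (hc : IsCompact S) {v : Pt} (hv : v ≠ 0) (o : Pt) :
    BddAbove {s : ℝ | o + s • v ∈ S} := by
  obtain ⟨M, hM⟩ := hc.isBounded.exists_norm_le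
  refine ⟨(M + ‖o‖) / ‖v‖, fun s hs => ?_⟩
  rw [le_div_iff₀ (norm_pos_iff.2 hv)]
  have h1 := hM _ hs
  have h2 : ‖s • v‖ ≤ ‖o + s • v‖ + ‖o‖ := by
    have := norm_sub_le (o + s • v) o
    rwa [add_sub_cancel_left] at this
  rw [norm_smul] at h2
  have h3 : s * ‖v‖ ≤ ‖s‖ * ‖v‖ := mul_le_mul_of_nonneg_right (le_abs_self s) (norm_nonneg _)
  linarith

theorem add_reach_smul_mem {S : Set Pt} (hc : IsCompact S) {v : Pt} (hv : v ≠ 0) {o : Pt}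
    (ho : o ∈ S) : o + reach S v o • v ∈ S := by
  have hcl : IsClosed {s : ℝ | o + s • v ∈ S} :=
    hc.isClosed.preimage (by fun_prop : Continuous fun s : ℝ => o + s • v)
  exact hcl.csSup_mem ⟨0, by simpa using ho⟩ (bddAbove_reach hc hv o)

theorem le_reach {S : Set Pt} (hc : IsCompact S) {v : Pt} (hv : v ≠ 0) {o : Pt} {s : ℝ}
    (hs : o + s • v ∈ S) : s ≤ reach S v o :=
  le_csSup (bddAbove_reach hc hv o) hs

theorem exists_pos_add_smul_mem {S : Set Pt} {o : Pt} (ho : o ∈ interior S) (v : Pt) :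
    ∃ s : ℝ, 0 < s ∧ o + s • v ∈ S := by
  have hcont : Filter.Tendsto (fun t : ℝ => o + t • v) (nhdsWithin 0 (Ioi 0)) (nhds o) := by
    have : Continuous fun t : ℝ => o + t • v := by fun_prop
    have h0 := this.tendsto 0
    simp only [zero_smul, add_zero] at h0
    exact h0.mono_left nhdsWithin_le_nhds
  obtain ⟨t, ht, ht0⟩ := ((hcont.eventually (isOpen_interior.mem_nhds ho)).and
    self_mem_nhdsWithin).exists
  exact ⟨t, ht0, interior_subset ht⟩

theorem reach_pos {S : Set Pt} (hc : IsCompact S) {v : Pt} (hv : v ≠ 0) {o : Pt}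
    (ho : o ∈ interior S) : 0 < reach S v o := by
  obtain ⟨s, hs, h⟩ := exists_pos_add_smul_mem ho v
  exact hs.trans_le (le_reach hc hv h)

theorem add_reach_smul_mem_frontier {S : Set Pt} (hc : IsCompact S) {v : Pt} (hv : v ≠ 0) {o : Pt}
    (ho : o ∈ S) : o + reach S v o • v ∈ frontier S := by
  rw [hc.isClosed.frontier_eq]
  refine ⟨add_reach_smul_mem hc hv ho, fun h => ?_⟩
  obtain ⟨s, hs, h1⟩ := exists_pos_add_smul_mem h v
  rw [add_assoc, ← add_smul] at h1
  linarith [le_reach hc hv h1]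

theorem concaveOn_reach {S : Set Pt} (hS : Convex ℝ S) (hc : IsCompact S) {v : Pt} (hv : v ≠ 0) :
    ConcaveOn ℝ S (reach S v) := by
  refine ⟨hS, fun x hx y hy a b ha hb hab => le_reach hc hv ?_⟩
  convert hS (add_reach_smul_mem hc hv hx) (add_reach_smul_mem hc hv hy) ha hb hab using 1
  simp only [smul_eq_mul]
  module

theorem reach_eq_of_mem_frontier {S : Set Pt} (hS : Convex ℝ S) (hc : IsCompact S) {v : Pt}
    (hv : v ≠ 0) {o : Pt} (ho : o ∈ interior S) {s : ℝ} (hs : 0 ≤ s)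
    (h : o + s • v ∈ frontier S) : reach S v o = s := by
  rw [hc.isClosed.frontier_eq] at h
  refine le_antisymm (not_lt.1 fun hlt => h.2 ?_) (le_reach hc hv h.1)
  set α := reach S v o
  have hα : 0 < α := hs.trans_lt hlt
  have := hS.combo_interior_self_mem_interior ho
    (add_reach_smul_mem hc hv (interior_subset ho)) (a := 1 - s / α) (b := s / α)
    (by rw [sub_pos, div_lt_one hα]; exact hlt) (by positivity) (by ring)
  convert this using 1
  change o + s • v = (1 - s / α) • o + (s / α) • (o + α • v)
  match_scalars <;> field_simp
  ring

theorem inter_frontier_nonempty_of_isPreconnected {A S : Set Pt} (hA : IsPreconnected A)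
    (h1 : (A ∩ S).Nonempty) (h2 : (A ∩ Sᶜ).Nonempty) (hS : IsClosed S) :
    (A ∩ frontier S).Nonempty := by
  rw [hS.frontier_eq]
  by_contra h
  have hsub : A ∩ S ⊆ interior S := by
    rintro z ⟨hz, hzS⟩
    by_contra hzi
    exact h ⟨z, hz, hzS, hzi⟩
  obtain ⟨z, -, hz1, hz2⟩ := hA (interior S) Sᶜ isOpen_interior hS.isOpen_compl
    (fun z hz => by
      by_cases hzS : z ∈ S
      · exact Or.inl (hsub ⟨hz, hzS⟩)
      · exact Or.inr hzS)
    (by obtain ⟨z, hz⟩ := h1; exact ⟨z, hz.1, hsub hz⟩) h2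
  exact hz2 (interior_subset hz1)

/-- Between two copies through `p` and `q` one of which contains `x` and the other does not,
there is a copy through `p`, `q` and `x`. -/
theorem exists_through_three {S : Set Pt} (hS : StrictConvex ℝ S) (hc : IsCompact S)
    {p q : Pt} (hpq : p ≠ q) {r₀ r₁ : ℝ} {u₀ u₁ : Pt} (h₀ : Through S p q r₀ u₀)
    (h₁ : Through S p q r₁ u₁) {x : Pt} (hx₁ : r₁ • x + u₁ ∈ S) (hx₀ : r₀ • x + u₀ ∉ S) :
    ∃ (t r : ℝ) (u : Pt), 0 ≤ t ∧ t ≤ 1 ∧ Through S p q r u ∧ r • x + u ∈ frontier S ∧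
      crs (q - p) (r • p + u) =
        (1 - t) * crs (q - p) (r₀ • p + u₀) + t * crs (q - p) (r₁ • p + u₁) := by
  obtain ⟨d, rfl⟩ : ∃ d, q = p + d := ⟨q - p, by abel⟩
  have hd : d ≠ 0 := fun h => hpq (by rw [h, add_zero])
  have hd' : -d ≠ 0 := neg_ne_zero.2 hd
  rw [add_sub_cancel_left]
  let mid : ℝ → Pt → Pt := fun r u => r • p + u + (r / 2) • d
  have hmid : ∀ r u, Through S p (p + d) r u → mid r u ∈ interior S ∧
      reach S (-d) (mid r u) = r / 2 ∧ reach S d (mid r u) = r / 2 := by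
    intro r u h
    have hr := h.pos
    have hi : mid r u ∈ interior S := by
      have := ((h.mem_iff_of_line hS hc.isClosed hpq (1 / 2)).2).2 (by norm_num)
      convert this using 1
      simp only [mid]
      module
    refine ⟨hi, reach_eq_of_mem_frontier hS.convex hc hd' hi (by positivity) ?_,
      reach_eq_of_mem_frontier hS.convex hc hd hi (by positivity) ?_⟩
    · convert h.left using 1; simp only [mid]; module
    · convert h.right using 1; simp only [mid]; module
  obtain ⟨i₀, a₀, b₀⟩ := hmid _ _ h₀
  obtain ⟨i₁, a₁, b₁⟩ := hmid _ _ h₁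
  let o : ℝ → Pt := fun t => (1 - t) • mid r₀ u₀ + t • mid r₁ u₁
  have ho : ∀ t ∈ Icc (0 : ℝ) 1, o t ∈ interior S := fun t ht =>
    hS.convex.interior i₀ i₁ (by linarith [ht.2]) ht.1 (by ring)
  let rr : ℝ → ℝ := fun t => reach S (-d) (o t) + reach S d (o t)
  let uu : ℝ → Pt := fun t => o t + reach S (-d) (o t) • (-d) - rr t • p
  have hthr : ∀ t ∈ Icc (0 : ℝ) 1, Through S p (p + d) (rr t) (uu t) := by
    intro t ht
    refine ⟨add_pos (reach_pos hc hd' (ho t ht)) (reach_pos hc hd (ho t ht)), ?_, ?_⟩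
    · convert add_reach_smul_mem_frontier hc hd' (interior_subset (ho t ht)) using 1
      simp only [uu]; abel
    · convert add_reach_smul_mem_frontier hc hd (interior_subset (ho t ht)) using 1
      simp only [uu, rr]; module
  have hocont : Continuous o := by fun_prop
  have hcα : ContinuousOn (fun t => reach S (-d) (o t)) (Icc 0 1) :=
    (concaveOn_reach hS.convex hc hd').continuousOn_interior.comp hocont.continuousOn ho
  have hcβ : ContinuousOn (fun t => reach S d (o t)) (Icc 0 1) :=
    (concaveOn_reach hS.convex hc hd).continuousOn_interior.comp hocont.continuousOn ho
  have hcont : ContinuousOn (fun t => rr t • x + uu t) (Icc 0 1) := by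
    have h1 : ContinuousOn rr (Icc 0 1) := hcα.add hcβ
    exact (h1.smul continuousOn_const).add
      ((hocont.continuousOn.add (hcα.smul continuousOn_const)).sub (h1.smul continuousOn_const))
  have e₀ : rr 0 = r₀ ∧ uu 0 = u₀ := by
    have : o 0 = mid r₀ u₀ := by simp [o]
    have h1 : rr 0 = r₀ := by simp only [rr, this, a₀, b₀]; ring
    refine ⟨h1, ?_⟩
    simp only [uu, h1, this, a₀, mid]
    module
  have e₁ : rr 1 = r₁ ∧ uu 1 = u₁ := by
    have : o 1 = mid r₁ u₁ := by simp [o]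
    have h1 : rr 1 = r₁ := by simp only [rr, this, a₁, b₁]; ring
    refine ⟨h1, ?_⟩
    simp only [uu, h1, this, a₁, mid]
    module
  obtain ⟨_, ⟨t, ht, rfl⟩, hfr⟩ := inter_frontier_nonempty_of_isPreconnected
    (isPreconnected_Icc.image _ hcont)
    ⟨_, ⟨1, right_mem_Icc.2 zero_le_one, rfl⟩,
      by change rr 1 • x + uu 1 ∈ S; rw [e₁.1, e₁.2]; exact hx₁⟩
    ⟨_, ⟨0, left_mem_Icc.2 zero_le_one, rfl⟩,
      by change rr 0 • x + uu 0 ∉ S; rw [e₀.1, e₀.2]; exact hx₀⟩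
    hc.isClosed
  refine ⟨t, rr t, uu t, ht.1, ht.2, hthr t ht, hfr, ?_⟩
  have e2 : rr t • p + uu t = o t + reach S (-d) (o t) • (-d) := by simp only [uu]; abel
  rw [e2]
  simp only [o, mid, smul_neg, crs_add_right, crs_smul_right, ← neg_smul, crs_self]
  ring

/-- The copy of `S` given by `(r, u)` passes through `x` and lies between the copies given by
`(r₀, u₀)` and `(r₁, u₁)`. -/
structure Between (S : Set Pt) (r₀ : ℝ) (u₀ : Pt) (r₁ : ℝ) (u₁ : Pt) (x : Pt) (r : ℝ) (u : Pt) :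
    Prop where
  pos : 0 < r
  mem_frontier : r • x + u ∈ frontier S
  mem_of_mem : ∀ y, r₀ • y + u₀ ∈ S → r₁ • y + u₁ ∈ S → r • y + u ∈ S
  mem_or_mem : ∀ y, r • y + u ∈ S → r₀ • y + u₀ ∈ S ∨ r₁ • y + u₁ ∈ S
  mem_frontier_of_mem : ∀ y, r₀ • y + u₀ ∈ frontier S → r₁ • y + u₁ ∈ frontier S →
    r • y + u ∈ frontier S

theorem exists_between_of_subset {S : Set Pt} (hS : Convex ℝ S) (hc : IsCompact S)
    {r₀ r₁ : ℝ} {u₀ u₁ x : Pt} (hr₀ : 0 < r₀) (hr₁ : 0 < r₁)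
    (hx₁ : r₁ • x + u₁ ∈ S) (hx₀ : r₀ • x + u₀ ∉ S)
    (hsub : ∀ y, r₀ • y + u₀ ∈ S → r₁ • y + u₁ ∈ S) :
    ∃ r u, Between S r₀ u₀ r₁ u₁ x r u := by
  let rr : ℝ → ℝ := fun t => (1 - t) * r₀ + t * r₁
  let uu : ℝ → Pt := fun t => (1 - t) • u₀ + t • u₁
  have hcomb : ∀ t y, rr t • y + uu t = (1 - t) • (r₀ • y + u₀) + t • (r₁ • y + u₁) := by
    intro t y
    simp only [rr, uu]
    module
  have hcont : Continuous fun t => rr t • x + uu t := by fun_prop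
  obtain ⟨_, ⟨t, ht, rfl⟩, hfr⟩ := inter_frontier_nonempty_of_isPreconnected
    (isPreconnected_Icc.image _ hcont.continuousOn)
    ⟨_, ⟨1, right_mem_Icc.2 zero_le_one, rfl⟩, by simpa [rr, uu] using hx₁⟩
    ⟨_, ⟨0, left_mem_Icc.2 zero_le_one, rfl⟩, by simpa [rr, uu] using hx₀⟩ hc.isClosed
  have hfrS : frontier S ⊆ S := hc.isClosed.frontier_subset
  have ht0 : 0 < t := by
    refine lt_of_le_of_ne ht.1 ?_
    rintro rfl
    exact hx₀ (by simpa [rr, uu] using hfrS hfr)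
  have h1t : 0 ≤ 1 - t := by linarith [ht.2]
  have hpos : 0 < rr t := add_pos_of_nonneg_of_pos (by positivity) (by positivity)
  have key : ∀ y, r₁ • y + u₁ = ((1 - t) * r₀ / rr t) •
      (r₁ • (r₀⁻¹ • (rr t • y + uu t - u₀)) + u₁) + (t * r₁ / rr t) • (rr t • y + uu t) := by
    intro y
    have hrt : rr t = (1 - t) * r₀ + t * r₁ := rfl
    simp only [uu]
    match_scalars <;> field_simp
    · ring
    · rw [hrt]; ring
    · ring
  have hy0 : ∀ y, rr t • y + uu t ∈ S → r₁ • (r₀⁻¹ • (rr t • y + uu t - u₀)) + u₁ ∈ S := by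
    intro y hy
    apply hsub
    rwa [smul_smul, mul_inv_cancel₀ hr₀.ne', one_smul, sub_add_cancel]
  have hsum : (1 - t) * r₀ / rr t + t * r₁ / rr t = 1 := by
    rw [← add_div]; exact div_self hpos.ne'
  refine ⟨rr t, uu t, hpos, hfr, ?_, ?_, ?_⟩
  · intro y h₀ h₁
    rw [hcomb]
    exact hS h₀ h₁ h1t ht.1 (by ring)
  · intro y hy
    right
    rw [key]
    exact hS (hy0 y hy) hy (by positivity) (by positivity) hsum
  · intro y h₀ h₁
    have hyS : rr t • y + uu t ∈ S := by
      rw [hcomb]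
      exact hS (hfrS h₀) (hfrS h₁) h1t ht.1 (by ring)
    rw [hc.isClosed.frontier_eq] at h₁ ⊢
    refine ⟨hyS, fun hi => h₁.2 ?_⟩
    rw [key]
    exact hS.combo_self_interior_mem_interior (hy0 y hyS) hi (by positivity) (by positivity) hsum

theorem exists_between_of_through {S : Set Pt} (hS : StrictConvex ℝ S) (hc : IsCompact S)
    {p q : Pt} (hpq : p ≠ q) {r₀ r₁ : ℝ} {u₀ u₁ : Pt} (h₀ : Through S p q r₀ u₀)
    (h₁ : Through S p q r₁ u₁) {x : Pt} (hx₁ : r₁ • x + u₁ ∈ S) (hx₀ : r₀ • x + u₀ ∉ S) :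
    ∃ r u, Between S r₀ u₀ r₁ u₁ x r u := by
  have hfrS : frontier S ⊆ S := hc.isClosed.frontier_subset
  by_cases hxfr : r₁ • x + u₁ ∈ frontier S
  · exact ⟨r₁, u₁, h₁.pos, hxfr, fun _ _ h => h, fun _ h => Or.inr h, fun _ _ h => h⟩
  obtain ⟨t, r, u, ht0, ht1, h, hx, hl⟩ := exists_through_three hS hc hpq h₀ h₁ hx₁ hx₀
  have hlne : crs (q - p) (r₁ • p + u₁) - crs (q - p) (r₀ • p + u₀) ≠ 0 := by
    intro h0
    obtain ⟨rfl, rfl⟩ := Through.unique hS hc.isClosed hpq h₁ h₀ (sub_eq_zero.1 h0)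
    exact hx₀ hx₁
  have ht0' : 0 < t := by
    refine lt_of_le_of_ne ht0 ?_
    rintro rfl
    obtain ⟨rfl, rfl⟩ := Through.unique hS hc.isClosed hpq h h₀ (by rw [hl]; ring)
    exact hx₀ (hfrS hx)
  have ht1' : 0 < 1 - t := by
    refine sub_pos.2 (lt_of_le_of_ne ht1 ?_)
    rintro rfl
    obtain ⟨rfl, rfl⟩ := Through.unique hS hc.isClosed hpq h h₁ (by rw [hl]; ring)
    exact hxfr hx
  have hd : q - p ≠ 0 := sub_ne_zero.2 hpq.symm
  have hcases : ∀ y, (0 < crs (q - p) (y - p) *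
        (crs (q - p) (r₁ • p + u₁) - crs (q - p) (r₀ • p + u₀))) ∨
      (0 < crs (q - p) (y - p) *
        (crs (q - p) (r₀ • p + u₀) - crs (q - p) (r₁ • p + u₁))) ∨
      ∃ τ : ℝ, y = p + τ • (q - p) := by
    intro y
    rcases lt_trichotomy (crs (q - p) (y - p) *
        (crs (q - p) (r₁ • p + u₁) - crs (q - p) (r₀ • p + u₀))) 0 with h | h | h
    · right; left; linarith
    · right; right
      obtain ⟨τ, hτ⟩ := exists_eq_smul_of_crs_eq_zero hd
        ((mul_eq_zero.1 h).resolve_right hlne)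
      exact ⟨τ, by rw [← hτ]; abel⟩
    · exact Or.inl h
  refine ⟨r, u, h.pos, hx, ?_, ?_, ?_⟩
  · intro y hy₀ hy₁
    rcases hcases y with hy | hy | ⟨τ, rfl⟩
    · refine interior_subset (mem_interior_of_pencil hS hc.isClosed hpq h h₁ ?_ hy₁)
      rw [hl]; linear_combination mul_pos ht1' hy
    · refine interior_subset (mem_interior_of_pencil hS hc.isClosed hpq h h₀ ?_ hy₀)
      rw [hl]; linear_combination mul_pos ht0' hy
    · rw [(h₁.mem_iff_of_line hS hc.isClosed hpq τ).1] at hy₁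
      rwa [(h.mem_iff_of_line hS hc.isClosed hpq τ).1]
  · intro y hyS
    rcases hcases y with hy | hy | ⟨τ, rfl⟩
    · refine Or.inl (interior_subset (mem_interior_of_pencil hS hc.isClosed hpq h₀ h ?_ hyS))
      rw [hl]; linear_combination mul_pos ht0' hy
    · refine Or.inr (interior_subset (mem_interior_of_pencil hS hc.isClosed hpq h₁ h ?_ hyS))
      rw [hl]; linear_combination mul_pos ht1' hy
    · rw [(h.mem_iff_of_line hS hc.isClosed hpq τ).1] at hyS
      left
      rwa [(h₀.mem_iff_of_line hS hc.isClosed hpq τ).1]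
  · intro y hy₀ hy₁
    rw [hc.isClosed.frontier_eq] at hy₀ hy₁ ⊢
    rcases hcases y with hy | hy | ⟨τ, rfl⟩
    · exact absurd (mem_interior_of_pencil hS hc.isClosed hpq h₀ h₁ hy hy₁.1) hy₀.2
    · exact absurd (mem_interior_of_pencil hS hc.isClosed hpq h₁ h₀ hy hy₀.1) hy₁.2
    · have e₁ := h₁.mem_iff_of_line hS hc.isClosed hpq τ
      have e := h.mem_iff_of_line hS hc.isClosed hpq τ
      rw [mem_sdiff, e₁.1, e₁.2] at hy₁
      rwa [mem_sdiff, e.1, e.2]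

/-- Two overlapping homothetic copies of `S`, the second containing `x` and the first not, admit
a copy between them with `x` on its boundary. -/
theorem exists_between_copies {S : Set Pt} (hS : StrictConvex ℝ S) (hc : IsCompact S)
    {r₀ r₁ : ℝ} {u₀ u₁ m x : Pt} (hr₀ : 0 < r₀) (hr₁ : 0 < r₁)
    (hm₀ : r₀ • m + u₀ ∈ interior S) (hm₁ : r₁ • m + u₁ ∈ interior S)
    (hx₁ : r₁ • x + u₁ ∈ S) (hx₀ : r₀ • x + u₀ ∉ S) :
    ∃ r u, Between S r₀ u₀ r₁ u₁ x r u := by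
  by_cases hsub : ∀ y, r₀ • y + u₀ ∈ S → r₁ • y + u₁ ∈ S
  · exact exists_between_of_subset hS.convex hc hr₀ hr₁ hx₁ hx₀ hsub
  push Not at hsub
  obtain ⟨y, hy₀, hy₁⟩ := hsub
  obtain ⟨p, q, hpq, h₀, h₁⟩ :=
    exists_two_common_boundary_points hS.convex hc hr₀ hr₁ hm₀ hm₁ hx₁ hx₀ hy₀ hy₁
  exact exists_between_of_through hS hc hpq h₀ h₁ hx₁ hx₀

/-- The subset `Y` of `R` is captured by a homothetic copy of `S`. -/
def Capt (S : Set Pt) (R Y : Finset Pt) : Prop :=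
  ∃ (r : ℝ) (u : Pt), 0 < r ∧ ∀ x ∈ R, r • x + u ∈ S ↔ x ∈ Y

open Classical in
/-- All sets between `Y` and `Y ∪ B` are captured by homothetic copies of `S`. -/
def IsFace (S : Set Pt) (R B Y : Finset Pt) : Prop :=
  ∀ B' ⊆ B, Capt S R (Y ∪ B')

theorem eventually_add_smul_notMem {S : Set Pt} (hc : IsCompact S) (s : Pt) {v : Pt}
    (hv : v ≠ 0) : ∀ᶠ τ : ℝ in Filter.atTop, s + τ • v ∉ S := by
  obtain ⟨C, hC⟩ := hc.isBounded.exists_norm_le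
  have hv' : 0 < ‖v‖ := norm_pos_iff.2 hv
  filter_upwards [Filter.eventually_gt_atTop ((C + ‖s‖) / ‖v‖), Filter.eventually_gt_atTop 0]
    with τ hτ hτ0 hmem
  rw [div_lt_iff₀ hv'] at hτ
  have h1 := hC _ hmem
  have h2 : ‖τ • v‖ ≤ ‖s + τ • v‖ + ‖s‖ := by
    simpa using norm_sub_le (s + τ • v) s
  rw [norm_smul, Real.norm_of_nonneg hτ0.le] at h2
  linarith

/-- A tiny copy of `S` around `x`, with `x` in the position of a prescribed point of `S`. -/
theorem exists_copy_avoiding {S : Set Pt} (hc : IsCompact S) (R : Finset Pt) (s x : Pt) :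
    ∃ (r : ℝ) (u : Pt), 0 < r ∧ r • x + u = s ∧ ∀ y ∈ R, y ≠ x → r • y + u ∉ S := by
  have h : ∀ᶠ τ : ℝ in Filter.atTop, ∀ y ∈ R, y ≠ x → s + τ • (y - x) ∉ S := by
    rw [Filter.eventually_all_finset]
    intro y _
    by_cases hy : y = x
    · simp [hy]
    · filter_upwards [eventually_add_smul_notMem hc s (sub_ne_zero.2 hy)] with τ hτ _ using hτ
  obtain ⟨τ, hτ, hτ0⟩ := (h.and (Filter.eventually_gt_atTop 0)).exists
  refine ⟨τ, s - τ • x, hτ0, by abel, fun y hy hyx => ?_⟩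
  convert hτ y hy hyx using 2
  rw [smul_sub]
  abel

/-- Shrinking a copy of `S` towards one of its points `b` until `x` is on the boundary. -/
theorem exists_shrink {S : Set Pt} (hS : Convex ℝ S) (hc : IsCompact S) {r₁ : ℝ} {u₁ b x : Pt}
    (hr₁ : 0 < r₁) (hb : r₁ • b + u₁ ∈ S) (hx : r₁ • x + u₁ ∈ S) (hbx : x ≠ b) :
    ∃ (r : ℝ) (u : Pt), 0 < r ∧ r • x + u ∈ frontier S ∧ r • b + u = r₁ • b + u₁ ∧
      ∀ y, r • y + u ∈ S → r₁ • y + u₁ ∈ S := by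
  have hv : r₁ • (x - b) ≠ 0 := smul_ne_zero hr₁.ne' (sub_ne_zero.2 hbx)
  obtain ⟨M, hM, hM1⟩ := ((eventually_add_smul_notMem hc (r₁ • b + u₁) hv).and
    (Filter.eventually_ge_atTop 1)).exists
  have hcont : Continuous fun τ : ℝ => r₁ • b + u₁ + τ • r₁ • (x - b) := by fun_prop
  obtain ⟨_, ⟨τ, hτ, rfl⟩, hfr⟩ := inter_frontier_nonempty_of_isPreconnected
    (isPreconnected_Icc.image _ hcont.continuousOn)
    ⟨_, ⟨1, left_mem_Icc.2 hM1, rfl⟩, by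
      convert hx using 1
      module⟩
    ⟨_, ⟨M, right_mem_Icc.2 hM1, rfl⟩, hM⟩ hc.isClosed
  have hτ0 : 0 < τ := by linarith [hτ.1]
  refine ⟨r₁ * τ, u₁ + (r₁ * (1 - τ)) • b, by positivity, ?_, ?_, ?_⟩
  · convert hfr using 1
    module
  · module
  · intro y hy
    have := hS hb hy (a := 1 - 1 / τ) (b := 1 / τ)
      (by rw [sub_nonneg, div_le_one hτ0]; exact hτ.1) (by positivity) (by ring)
    convert this using 1
    match_scalars <;> field_simp <;> ring

open Classical in
theorem IsFace.exists_boundary {S : Set Pt} (hS : NiceShape S) {R : Finset Pt} (B : Finset Pt) :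
    ∀ Y : Finset Pt, B ⊆ R → Y ⊆ R → Disjoint B Y → IsFace S R B Y →
      ∃ (r : ℝ) (u : Pt), 0 < r ∧ (∀ b ∈ B, r • b + u ∈ frontier S) ∧
        ∀ x ∈ R, r • x + u ∈ S ↔ x ∈ Y ∪ B := by
  have hsc := hS.strictConvex
  have hc : IsCompact S := hS.2.2.1
  have hfrS : frontier S ⊆ S := hc.isClosed.frontier_subset
  induction B using Finset.induction_on with
  | empty =>
    intro Y _ _ _ h
    obtain ⟨r, u, hr, h⟩ := h ∅ (Finset.Subset.refl _)
    exact ⟨r, u, hr, by simp, h⟩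
  | insert x B hxB ih =>
    intro Y hBR hYR hdisj hface
    rw [Finset.disjoint_insert_left] at hdisj
    have hxR : x ∈ R := hBR (Finset.mem_insert_self _ _)
    have hBR' : B ⊆ R := (Finset.subset_insert _ _).trans hBR
    obtain ⟨r₀, u₀, hr₀, hB₀, hR₀⟩ := ih Y hBR' hYR hdisj.2
      fun B' hB' => hface B' (hB'.trans (Finset.subset_insert _ _))
    obtain ⟨r₁, u₁, hr₁, hB₁, hR₁⟩ := ih (insert x Y) hBR'
      (Finset.insert_subset hxR hYR) (Finset.disjoint_insert_right.2 ⟨hxB, hdisj.2⟩)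
      fun B' hB' => by
        have := hface (insert x B') (Finset.insert_subset_insert _ hB')
        rwa [Finset.union_insert, ← Finset.insert_union] at this
    have hx₁ : r₁ • x + u₁ ∈ S := (hR₁ x hxR).2 (by simp)
    have hx₀ : r₀ • x + u₀ ∉ S := by rw [hR₀ x hxR]; simp [hxB, hdisj.1]
    have hsub₁ : ∀ y ∈ Y ∪ B, y ∈ R ∧ r₀ • y + u₀ ∈ S ∧ r₁ • y + u₁ ∈ S := by
      intro y hy
      have hyR : y ∈ R := Finset.union_subset hYR hBR' hy
      refine ⟨hyR, (hR₀ y hyR).2 hy, (hR₁ y hyR).2 ?_⟩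
      rw [Finset.insert_union]
      exact Finset.mem_insert_of_mem hy
    rcases (Y ∪ B).eq_empty_or_nonempty with hemp | ⟨b, hb⟩
    · obtain ⟨s, hs⟩ : (frontier S).Nonempty := by
        have := inter_frontier_nonempty_of_isPreconnected (S := S) isPreconnected_univ
          ⟨_, mem_univ _, hx₁⟩ ⟨_, mem_univ _, hx₀⟩ hc.isClosed
        exact this.mono inter_subset_right
      obtain ⟨r, u, hr, hxs, havoid⟩ := exists_copy_avoiding hc R s x
      obtain ⟨rfl, rfl⟩ := Finset.union_eq_empty.1 hemp
      refine ⟨r, u, hr, by simpa [hxs] using hs, fun y hy => ?_⟩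
      by_cases hyx : y = x
      · simpa [hyx, hxs] using hfrS hs
      · simpa [hyx] using havoid y hy hyx
    have hbx : x ≠ b := by
      rintro rfl
      exact hx₀ (hsub₁ _ hb).2.1
    have fin : ∀ (r : ℝ) (u : Pt), r • x + u ∈ frontier S →
        (∀ y ∈ Y ∪ B, r • y + u ∈ S) → (∀ y, r • y + u ∈ S → r₀ • y + u₀ ∈ S ∨ r₁ • y + u₁ ∈ S) →
        ∀ y ∈ R, r • y + u ∈ S ↔ y ∈ Y ∪ insert x B := by
      intro r u hxf hin hout y hyR
      rw [Finset.union_insert, Finset.mem_insert]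
      constructor
      · intro hy
        rcases hout y hy with h | h
        · exact Or.inr ((hR₀ y hyR).1 h)
        · rwa [hR₁ y hyR, Finset.insert_union, Finset.mem_insert] at h
      · rintro (rfl | hy)
        · exact hfrS hxf
        · exact hin y hy
    by_cases htwo : ∃ a ∈ Y ∪ B, a ≠ b
    · obtain ⟨a, ha, hab⟩ := htwo
      have hmid : ∀ (r : ℝ) (u : Pt), 0 < r → r • a + u ∈ S → r • b + u ∈ S →
          r • ((1 / 2 : ℝ) • a + (1 / 2 : ℝ) • b) + u ∈ interior S := by
        intro r u hr h1 h2
        refine hsc.mem_interior_of_combo h1 h2 (t := 1 / 2) ?_ (by norm_num) (by norm_num) ?_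
        · intro h
          exact hab (smul_right_injective _ hr.ne' (add_right_cancel h))
        · module
      obtain ⟨r, u, h⟩ := exists_between_copies hsc hc hr₀ hr₁
        (hmid r₀ u₀ hr₀ (hsub₁ a ha).2.1 (hsub₁ b hb).2.1)
        (hmid r₁ u₁ hr₁ (hsub₁ a ha).2.2 (hsub₁ b hb).2.2) hx₁ hx₀
      refine ⟨r, u, h.pos, ?_, fin r u h.mem_frontier
        (fun y hy => h.mem_of_mem y (hsub₁ y hy).2.1 (hsub₁ y hy).2.2) h.mem_or_mem⟩
      intro y hy
      rcases Finset.mem_insert.1 hy with rfl | hy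
      · exact h.mem_frontier
      · exact h.mem_frontier_of_mem y (hB₀ y hy) (hB₁ y hy)
    · push Not at htwo
      obtain ⟨r, u, hr, hxf, hrb, hsub⟩ :=
        exists_shrink hsc.convex hc hr₁ (hsub₁ b hb).2.2 hx₁ hbx
      refine ⟨r, u, hr, ?_, fin r u hxf ?_ fun y hy => Or.inr (hsub y hy)⟩
      · intro y hy
        rcases Finset.mem_insert.1 hy with rfl | hy
        · exact hxf
        · have := hB₁ y hy
          rw [htwo y (Finset.mem_union_right _ hy)] at this ⊢
          rwa [hrb]
      · intro y hy
        rw [htwo y hy, hrb]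
        exact (hsub₁ b hb).2.2

open scoped Topology

theorem continuous_smul_add (z : Pt) : Continuous fun a : ℝ × Pt => a.1 • z + a.2 := by
  fun_prop

theorem frequently_nhds_of_tendsto {P : ℝ × Pt → Prop} {a : ℝ × Pt} (γ : ℝ → ℝ × Pt)
    (hγ : Continuous γ) (hγ0 : γ 0 = a) (h : ∀ᶠ t in 𝓝[>] (0 : ℝ), P (γ t)) :
    ∃ᶠ b in 𝓝 a, P b := by
  have ht : Filter.Tendsto γ (𝓝[>] 0) (𝓝 a) := by
    rw [← hγ0]
    exact (hγ.tendsto 0).mono_left nhdsWithin_le_nhds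
  exact ht.frequently h.frequently

theorem frequently_expand_all {S : Set Pt} (hS : Convex ℝ S) {m : Pt} (hm : m ∈ interior S)
    {F : Finset Pt} (hF : ∀ z ∈ F, z ∉ interior S) :
    ∃ᶠ a : ℝ × Pt in 𝓝 (1, 0), ∀ z ∈ F, a.1 • z + a.2 ∉ S := by
  refine frequently_nhds_of_tendsto (fun η => (1 + η, -(η • m))) (by fun_prop) (by simp) ?_
  filter_upwards [self_mem_nhdsWithin] with η hη z hz hmem
  rw [mem_Ioi] at hη
  apply hF z hz
  have := hS.combo_interior_self_mem_interior hm hmem (a := η / (1 + η)) (b := 1 / (1 + η))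
    (by positivity) (by positivity) (by field_simp; ring)
  convert this using 1
  match_scalars <;> field_simp
  ring

theorem frequently_expand_away {S : Set Pt} (hS : StrictConvex ℝ S) (hc : IsClosed S)
    {m p : Pt} (hm : m ∈ interior S) (hp : p ∈ S) {F : Finset Pt} (hF : ∀ z ∈ F, z ∉ interior S) :
    ∃ᶠ a : ℝ × Pt in 𝓝 (1, 0), ∀ z ∈ F, a.1 • z + a.2 ∈ S ↔ z = p := by
  rw [← frequently_frequently_nhds]
  refine frequently_nhds_of_tendsto (fun η => (1 + η, -(η • p))) (by fun_prop) (by simp) ?_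
  filter_upwards [Ioo_mem_nhdsGT zero_lt_one] with η hη
  have hη0 : 0 < η := hη.1
  refine frequently_nhds_of_tendsto (fun δ => (1 + η, -(η • p) + (η * δ) • (m - p)))
    (by fun_prop) (by simp) ?_
  rw [Filter.eventually_all_finset]
  intro z hz
  by_cases hzp : z = p
  · filter_upwards [Ioo_mem_nhdsGT zero_lt_one] with δ hδ
    have h1 : η * δ ≤ 1 := by nlinarith [hη.2, hδ.1, hδ.2]
    refine iff_of_true ?_ hzp
    have := hS.convex hp (interior_subset hm) (a := 1 - η * δ) (b := η * δ) (by linarith)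
      (mul_nonneg hη0.le hδ.1.le) (by ring)
    convert this using 1
    rw [hzp]
    module
  · have hout : (1 + η) • z + -(η • p) ∉ S := by
      intro hmem
      apply hF z hz
      refine hS.mem_interior_of_combo hp hmem ?_ (t := 1 / (1 + η)) (by positivity)
        (by rw [div_lt_one (by linarith)]; linarith) ?_
      · intro h
        have : (1 + η) • (z - p) = 0 := by
          rw [smul_sub, sub_eq_zero, ← sub_eq_zero]
          nth_rewrite 1 [← sub_eq_zero] at h
          rw [← neg_eq_zero, ← h]
          module
        rcases smul_eq_zero.1 this with h | h
        · linarith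
        · exact hzp (sub_eq_zero.1 h)
      · match_scalars <;> field_simp
        ring
    have hcont : Continuous fun δ : ℝ => (1 + η) • z + (-(η • p) + (η * δ) • (m - p)) := by fun_prop
    have : ∀ᶠ δ in 𝓝 (0 : ℝ), (1 + η) • z + (-(η • p) + (η * δ) • (m - p)) ∈ Sᶜ :=
      hcont.continuousAt.eventually_mem (hc.isOpen_compl.mem_nhds (by simpa using hout))
    filter_upwards [nhdsWithin_le_nhds this] with δ hδ using iff_of_false hδ hzp

theorem frequently_shrink_away {S : Set Pt} (hS : StrictConvex ℝ S)
    {m p : Pt} (hm : m ∈ interior S) (hp : p ∈ frontier S) {F : Finset Pt} (hF : ∀ z ∈ F, z ∈ S)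
    (hpS : p ∈ S) :
    ∃ᶠ a : ℝ × Pt in 𝓝 (1, 0), ∀ z ∈ F, a.1 • z + a.2 ∈ S ↔ z ≠ p := by
  rw [← frequently_frequently_nhds]
  refine frequently_nhds_of_tendsto (fun η => (1 - η, η • p)) (by fun_prop) (by simp) ?_
  filter_upwards [Ioo_mem_nhdsGT zero_lt_one] with η hη
  have hη0 : 0 < η := hη.1
  refine frequently_nhds_of_tendsto (fun δ => (1 - η, η • p - (η * δ) • (m - p)))
    (by fun_prop) (by simp) ?_
  rw [Filter.eventually_all_finset]
  intro z hz
  by_cases hzp : z = p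
  · filter_upwards [Ioo_mem_nhdsGT zero_lt_one] with δ hδ
    refine iff_of_false (fun hmem => ?_) (not_not.2 hzp)
    have hδ0 : 0 < η * δ := mul_pos hη0 hδ.1
    have := hS.convex.combo_interior_self_mem_interior hm hmem
      (a := η * δ / (1 + η * δ)) (b := 1 / (1 + η * δ))
      (by positivity) (by positivity) (by field_simp; ring)
    refine hp.2 ?_
    convert this using 1
    rw [hzp]
    match_scalars <;> field_simp <;> ring
  · have hin : (1 - η) • z + η • p ∈ interior S :=
      hS.mem_interior_of_combo (hF z hz) hpS hzp hη.1 hη.2 rfl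
    have hcont : Continuous fun δ : ℝ => (1 - η) • z + (η • p - (η * δ) • (m - p)) := by fun_prop
    have : ∀ᶠ δ in 𝓝 (0 : ℝ), (1 - η) • z + (η • p - (η * δ) • (m - p)) ∈ interior S :=
      hcont.continuousAt.eventually_mem (isOpen_interior.mem_nhds (by simpa using hin))
    filter_upwards [nhdsWithin_le_nhds this] with δ hδ using iff_of_true (interior_subset hδ) hzp

theorem eventually_mem_iff {S : Set Pt} (hc : IsClosed S) (Z : Finset Pt) :
    ∀ᶠ a : ℝ × Pt in 𝓝 (1, 0), ∀ z ∈ Z, z ∉ frontier S → (a.1 • z + a.2 ∈ S ↔ z ∈ S) := by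
  rw [Filter.eventually_all_finset]
  intro z _
  have hcont : Filter.Tendsto (fun a : ℝ × Pt => a.1 • z + a.2) (𝓝 (1, 0)) (𝓝 z) := by
    simpa using (continuous_smul_add z).tendsto (1, 0)
  by_cases hz : z ∈ S
  · by_cases hzi : z ∈ interior S
    · filter_upwards [hcont.eventually_mem (isOpen_interior.mem_nhds hzi)] with a ha _ using
        iff_of_true (interior_subset ha) hz
    · filter_upwards with a ha using absurd (hc.frontier_eq ▸ ⟨hz, hzi⟩) ha
  · filter_upwards [hcont.eventually_mem (hc.isOpen_compl.mem_nhds hz)] with a ha _ using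
      iff_of_false ha hz

open Classical in
/-- At most three points on the boundary of `S` can be pushed out of `S` independently of each
other by a small perturbation. -/
theorem exists_perturbation {S : Set Pt} (hS : NiceShape S) {Z C : Finset Pt}
    (hcard : (Z.filter (· ∈ frontier S)).card ≤ 3) (hC : C ⊆ Z.filter (· ∈ frontier S)) :
    ∃ (κ : ℝ) (v : Pt), 0 < κ ∧ ∀ z ∈ Z, κ • z + v ∈ S ↔ z ∈ S ∧ z ∉ C := by
  have hsc := hS.strictConvex
  have hc : IsClosed S := hS.2.2.1.isClosed
  obtain ⟨m, hm⟩ := hS.interior_nonempty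
  set F := Z.filter (· ∈ frontier S) with hF
  have hFf : ∀ z ∈ F, z ∈ frontier S := fun z hz => (Finset.mem_filter.1 hz).2
  have hFS : ∀ z ∈ F, z ∈ S := fun z hz => hc.frontier_subset (hFf z hz)
  have hFi : ∀ z ∈ F, z ∉ interior S := fun z hz => (hFf z hz).2
  have key : ∃ᶠ a : ℝ × Pt in 𝓝 (1, 0), ∀ z ∈ F, a.1 • z + a.2 ∈ S ↔ z ∉ C := by
    have hsum := Finset.card_sdiff_add_card_eq_card hC
    have hcases : C.card = 0 ∨ C.card = 1 ∨ (F \ C).card = 0 ∨ (F \ C).card = 1 := by omega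
    rcases hcases with h | h | h | h
    · obtain rfl := Finset.card_eq_zero.1 h
      refine frequently_nhds_of_tendsto (fun _ => (1, 0)) continuous_const rfl ?_
      filter_upwards with _ z hz
      simpa using hFS z hz
    · obtain ⟨p, rfl⟩ := Finset.card_eq_one.1 h
      have hp : p ∈ F := hC (by simp)
      refine (frequently_shrink_away hsc hm (hFf p hp) hFS (hFS p hp)).mono fun a ha z hz => ?_
      rw [ha z hz, Finset.mem_singleton]
    · refine (frequently_expand_all hsc.convex hm hFi).mono fun a ha z hz => ?_
      have hzC : z ∈ C := Finset.sdiff_eq_empty_iff_subset.1 (Finset.card_eq_zero.1 h) hz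
      exact iff_of_false (ha z hz) (not_not.2 hzC)
    · obtain ⟨p, hp⟩ := Finset.card_eq_one.1 h
      have hpF : p ∈ F := (Finset.mem_sdiff.1 (hp ▸ Finset.mem_singleton_self p)).1
      refine (frequently_expand_away hsc hc hm (hFS p hpF) hFi).mono fun a ha z hz => ?_
      rw [ha z hz, ← Finset.mem_singleton, ← hp, Finset.mem_sdiff]
      exact and_iff_right hz
  have hpos : ∀ᶠ a : ℝ × Pt in 𝓝 (1, 0), 0 < a.1 :=
    continuous_fst.continuousAt.eventually_mem (isOpen_Ioi.mem_nhds (by simp))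
  obtain ⟨a, h1, h2, h3⟩ := (key.and_eventually ((eventually_mem_iff hc Z).and hpos)).exists
  refine ⟨a.1, a.2, h3, fun z hz => ?_⟩
  by_cases hzf : z ∈ frontier S
  · have hzF : z ∈ F := Finset.mem_filter.2 ⟨hz, hzf⟩
    rw [h1 z hzF]
    exact (and_iff_right (hFS z hzF)).symm
  · rw [h2 z hz hzf]
    exact (and_iff_left fun hzC => hzf (hFf z (hC hzC))).symm

theorem NoFourOnBoundary.card_le_three {S A : Set Pt} (h : NoFourOnBoundary S A) {r : ℝ} {u : Pt}
    (hr : 0 < r) {F : Finset Pt} (hFA : ∀ x ∈ F, x ∈ A) (hF : ∀ x ∈ F, r • x + u ∈ frontier S) :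
    F.card ≤ 3 := by
  by_contra hcard
  push Not at hcard
  obtain ⟨e⟩ := Function.Embedding.nonempty_of_card_le (α := Fin 4) (β := F)
    (by rw [Fintype.card_fin, Fintype.card_coe]; exact hcard)
  have hmem : ∀ i, ((e i : F) : Pt) ∈ A ∩ frontier {x | r • x + u ∈ S} := by
    intro i
    rw [frontier_setOf_smul_add_mem S hr u]
    exact ⟨hFA _ (e i).2, hF _ (e i).2⟩
  have hne : ∀ i j, i ≠ j → ((e i : F) : Pt) ≠ e j :=
    fun i j hij h => hij (e.injective (Subtype.ext h))
  exact h _ (isRange_iff.2 ⟨r, u, hr, rfl⟩) _ _ _ _ (hmem 0) (hmem 1) (hmem 2) (hmem 3)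
    (hne _ _ (by decide)) (hne _ _ (by decide)) (hne _ _ (by decide)) (hne _ _ (by decide))
    (hne _ _ (by decide)) (hne _ _ (by decide))

theorem NoFourOnBoundary.exists_perturbation {S : Set Pt} (hS : NiceShape S) {R : Finset Pt}
    (h : NoFourOnBoundary S R) {r : ℝ} {u : Pt} (hr : 0 < r) {C : Finset Pt} (hCR : C ⊆ R)
    (hC : ∀ x ∈ C, r • x + u ∈ frontier S) :
    ∃ (r' : ℝ) (u' : Pt), 0 < r' ∧ ∀ x ∈ R, r' • x + u' ∈ S ↔ r • x + u ∈ S ∧ x ∉ C := by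
  classical
  let g : Pt → Pt := fun x => r • x + u
  have hg : Function.Injective g := fun x y hxy =>
    smul_right_injective _ hr.ne' (add_right_cancel hxy)
  obtain ⟨κ, v, hκ, hv⟩ := _root_.exists_perturbation hS (Z := R.image g) (C := C.image g)
    (by
      rw [Finset.filter_image]
      refine Finset.card_image_le.trans (h.card_le_three (u := u) hr ?_ ?_)
      · exact fun x hx => (Finset.mem_filter.1 hx).1
      · exact fun x hx => (Finset.mem_filter.1 hx).2)
    (by
      intro z hz
      obtain ⟨x, hx, rfl⟩ := Finset.mem_image.1 hz
      exact Finset.mem_filter.2 ⟨Finset.mem_image_of_mem _ (hCR hx), hC x hx⟩)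
  refine ⟨κ * r, κ • u + v, mul_pos hκ hr, fun x hx => ?_⟩
  have := hv _ (Finset.mem_image_of_mem g hx)
  rw [hg.mem_finset_image] at this
  rw [← this]
  simp only [g]
  rw [smul_add, smul_smul, add_assoc]

theorem NoFourOnBoundary.mono {S A A' : Set Pt} (h : NoFourOnBoundary S A) (hA : A' ⊆ A) :
    NoFourOnBoundary S A' := by
  have hsub := fun T : Set Pt => inter_subset_inter_left (frontier T) hA
  exact fun T hT p₁ p₂ p₃ p₄ h₁ h₂ h₃ h₄ =>
    h T hT p₁ p₂ p₃ p₄ (hsub T h₁) (hsub T h₂) (hsub T h₃) (hsub T h₄)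

theorem Capt.erase {S : Set Pt} {R Y Y' : Finset Pt} [DecidableEq Pt] {w : Pt} (h : Capt S R Y)
    (hY : ∀ x, x ≠ w → (x ∈ Y ↔ x ∈ Y')) : Capt S (R.erase w) Y' := by
  obtain ⟨r, u, hr, h⟩ := h
  refine ⟨r, u, hr, fun x hx => ?_⟩
  rw [Finset.mem_erase] at hx
  rw [h x hx.2, hY x hx.1]

open Classical in
theorem isFace_erase_iff {S : Set Pt} (hS : NiceShape S) {R : Finset Pt}
    (h : NoFourOnBoundary S R) {w : Pt} (hw : w ∈ R) {B Y : Finset Pt} (hB : B ⊆ R.erase w)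
    (hY : Y ⊆ R.erase w) (hdisj : Disjoint B Y) :
    IsFace S (R.erase w) B Y ↔ IsFace S R B Y ∨ IsFace S R B (insert w Y) := by
  constructor
  · intro hface
    obtain ⟨r, u, hr, hBf, hR⟩ := IsFace.exists_boundary hS B Y hB hY hdisj hface
    have hwB : w ∉ B := fun hwB => Finset.notMem_erase _ _ (hB hwB)
    have hwY : w ∉ Y := fun hwY => Finset.notMem_erase _ _ (hY hwY)
    have hpert : ∀ B' ⊆ B, ∃ (r' : ℝ) (u' : Pt), 0 < r' ∧
        ∀ x ∈ R, r' • x + u' ∈ S ↔ r • x + u ∈ S ∧ x ∉ B \ B' := fun B' _ =>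
      h.exists_perturbation hS hr ((Finset.sdiff_subset.trans hB).trans (Finset.erase_subset _ _))
        fun x hx => hBf x (Finset.mem_sdiff.1 hx).1
    by_cases hwT : r • w + u ∈ S
    · right
      intro B' hB'
      obtain ⟨r', u', hr', h'⟩ := hpert B' hB'
      refine ⟨r', u', hr', fun x hx => ?_⟩
      rw [h' x hx]
      by_cases hxw : x = w
      · subst hxw
        simp [hwT, hwB]
      · rw [hR x (Finset.mem_erase.2 ⟨hxw, hx⟩)]
        have h1 : x ∈ B' → x ∈ B := fun h => hB' h
        have h2 : x ∈ B → x ∉ Y := fun h => Finset.disjoint_left.1 hdisj h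
        simp only [Finset.mem_union, Finset.mem_sdiff, Finset.mem_insert, hxw, false_or]
        tauto
    · left
      intro B' hB'
      obtain ⟨r', u', hr', h'⟩ := hpert B' hB'
      refine ⟨r', u', hr', fun x hx => ?_⟩
      rw [h' x hx]
      by_cases hxw : x = w
      · subst hxw
        have : x ∉ B' := fun h => hwB (hB' h)
        simp [hwT, hwY, this]
      · rw [hR x (Finset.mem_erase.2 ⟨hxw, hx⟩)]
        have h1 : x ∈ B' → x ∈ B := fun h => hB' h
        have h2 : x ∈ B → x ∉ Y := fun h => Finset.disjoint_left.1 hdisj h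
        simp only [Finset.mem_union, Finset.mem_sdiff]
        tauto
  · rintro (hface | hface)
    · exact fun B' hB' => (hface B' hB').erase fun _ _ => Iff.rfl
    · exact fun B' hB' => (hface B' hB').erase fun x hx => by simp [hx]

open Classical in
theorem isFace_insert_iff {S : Set Pt} {R : Finset Pt} {w : Pt} {B Y : Finset Pt} :
    IsFace S R (insert w B) Y ↔ IsFace S R B Y ∧ IsFace S R B (insert w Y) := by
  constructor
  · intro h
    refine ⟨fun B' hB' => h B' (hB'.trans (Finset.subset_insert _ _)), fun B' hB' => ?_⟩
    have := h (insert w B') (Finset.insert_subset_insert _ hB')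
    rwa [Finset.union_insert, ← Finset.insert_union] at this
  · rintro ⟨h1, h2⟩ B' hB'
    by_cases hw : w ∈ B'
    · have := h2 (B'.erase w) (Finset.subset_insert_iff.1 hB')
      rwa [Finset.insert_union, ← Finset.union_insert, Finset.insert_erase hw] at this
    · exact h1 B' ((Finset.subset_insert_iff_of_notMem hw).1 hB')

theorem faceCount_eq_zero {V : Type*} {Q : Finset V → Finset V → Finset V → Prop}
    {R : Finset V} {d : ℕ} (h : ∀ B Y, B ⊆ R → Y ⊆ R → B.card = d → Disjoint B Y → ¬ Q R B Y)
    (k : ℕ) : faceCount Q R d k = 0 := by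
  classical
  rw [faceCount, Finset.card_eq_zero, Finset.filter_eq_empty_iff]
  rintro ⟨B, Y⟩ hBY ⟨hdisj, hQ⟩
  simp only [Finset.mem_product, Finset.mem_powersetCard] at hBY
  exact h B Y hBY.1.1 hBY.2.1 hBY.1.2 hdisj hQ

open Classical in
theorem faceCount_zero_left {V : Type*} (Q : Finset V → Finset V → Finset V → Prop)
    (R : Finset V) (k : ℕ) :
    faceCount Q R 0 k = ((R.powersetCard k).filter fun Y => Q R ∅ Y).card := by
  rw [faceCount, Finset.powersetCard_zero, Finset.singleton_product, Finset.filter_map,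
    Finset.card_map]
  congr 1
  exact Finset.filter_congr fun Y _ => by simp

theorem faceCount_four {S : Set Pt} (hS : NiceShape S) {R : Finset Pt}
    (h : NoFourOnBoundary S R) (k : ℕ) : faceCount (IsFace S) R 4 k = 0 := by
  refine faceCount_eq_zero (fun B Y hB hY hcard hdisj hface => ?_) k
  obtain ⟨r, u, hr, hBf, -⟩ := IsFace.exists_boundary hS B Y hB hY hdisj hface
  have := h.card_le_three hr (fun x hx => hB hx) hBf
  omega

open Classical in
theorem faceCount_isFace_zero (S : Set Pt) (R : Finset Pt) (k : ℕ) :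
    faceCount (IsFace S) R 0 k = ((R.powersetCard k).filter fun Y => Capt S R Y).card := by
  rw [faceCount_zero_left]
  congr 1
  refine Finset.filter_congr fun Y _ => ⟨fun h => ?_, fun h B' hB' => ?_⟩
  · simpa using h ∅ (Finset.Subset.refl _)
  · rwa [Finset.subset_empty.1 hB', Finset.union_empty]

theorem capt_empty {S : Set Pt} (hc : IsCompact S) (R : Finset Pt) : Capt S R ∅ := by
  obtain ⟨x, hx⟩ := Infinite.exists_notMem_finset R
  obtain ⟨r, u, hr, -, h⟩ := exists_copy_avoiding hc R 0 x
  refine ⟨r, u, hr, fun y hy => iff_of_false (h y hy ?_) (Finset.notMem_empty _)⟩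
  rintro rfl
  exact hx hy

theorem capt_singleton {S : Set Pt} (hne : S.Nonempty) (hc : IsCompact S) (R : Finset Pt) (x : Pt) :
    Capt S R {x} := by
  obtain ⟨s, hs⟩ := hne
  obtain ⟨r, u, hr, hx, h⟩ := exists_copy_avoiding hc R s x
  refine ⟨r, u, hr, fun y hy => ?_⟩
  rw [Finset.mem_singleton]
  by_cases hyx : y = x
  · exact iff_of_true (by rwa [hyx, hx]) hyx
  · exact iff_of_false (h y hy hyx) hyx

theorem capt_self {S : Set Pt} (hS : (interior S).Nonempty) (R : Finset Pt) : Capt S R R := by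
  obtain ⟨m, hm⟩ := hS
  have h : ∀ᶠ r in 𝓝[>] (0 : ℝ), ∀ x ∈ R, r • x + m ∈ S := by
    rw [Filter.eventually_all_finset]
    intro x _
    have hcont : Continuous fun r : ℝ => r • x + m := by fun_prop
    filter_upwards [nhdsWithin_le_nhds (hcont.continuousAt.eventually_mem
      (isOpen_interior.mem_nhds (by simpa using hm) : interior S ∈ 𝓝 ((0 : ℝ) • x + m)))]
      with r hr using interior_subset hr
  obtain ⟨r, h, hr⟩ := (h.and self_mem_nhdsWithin).exists
  exact ⟨r, m, hr, fun x hx => iff_of_true (h x hx) hx⟩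

/-- For complements of single points, being captured by a copy of `S` amounts to being captured
by a halfplane. -/
theorem capt_iff_halfplaneCapt {S : Set Pt} (hS : NiceShape S) {R Y : Finset Pt} {x : Pt}
    (hx : x ∈ R) (hY : ∀ y ∈ R, y ∈ Y ↔ y ≠ x) : Capt S R Y ↔ HalfplaneCapt R Y := by
  constructor
  · rintro ⟨r, u, hr, h⟩
    have hxS : r • x + u ∉ S := by rw [h x hx, hY x hx]; simp
    obtain ⟨f, c, hf, hfx⟩ := geometric_hahn_banach_closed_point hS.2.1 hS.2.2.1.isClosed hxS
    refine ⟨f.toLinearMap, (c - f u) / r, ?_, fun y hy => ?_⟩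
    · obtain ⟨s, hs⟩ := hS.1
      intro h0
      have h1 : ∀ z, f z = 0 := fun z => LinearMap.congr_fun h0 z
      have := hf s hs
      rw [h1] at this hfx
      linarith
    · have e : ∀ z, f (r • z + u) = f z * r + f u := fun z => by simp [mul_comm]
      rw [ContinuousLinearMap.coe_coe, le_div_iff₀ hr]
      constructor
      · intro hle
        rw [hY y hy]
        rintro rfl
        rw [e] at hfx
        linarith
      · intro hyY
        have := hf _ ((h y hy).2 hyY)
        rw [e] at this
        linarith
  · rintro ⟨f, a, hf, h⟩
    have hxa : a < f x := by
      by_contra hle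
      exact (hY x hx).1 ((h x hx).1 (not_lt.1 hle)) rfl
    obtain ⟨x₀, hx₀⟩ := LinearMap.surjective hf ((a + f x) / 2)
    have hcont : Continuous f := f.continuous_of_finiteDimensional
    obtain ⟨s, hs, hmax⟩ := hS.2.2.1.exists_isMaxOn hS.1 hcont.continuousOn
    have hmax' : ∀ y ∈ S, f y ≤ f s := fun y hy => hmax hy
    have hev : ∀ᶠ t in 𝓝[>] (0 : ℝ), ∀ y ∈ R, y ≠ x → s + t • (y - x₀) ∈ S := by
      rw [Filter.eventually_all_finset]
      intro y hy
      by_cases hyx : y = x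
      · simp [hyx]
      have hya : f y ≤ a := (h y hy).2 ((hY y hy).2 hyx)
      obtain ⟨ε, hε, hmem⟩ := hS.exists_add_smul_mem hf hs hmax' (v := y - x₀)
        (by rw [map_sub, hx₀]; linarith)
      filter_upwards [Ioc_mem_nhdsGT hε] with t ht _ using hmem t ht.1 ht.2
    obtain ⟨t, hev, ht⟩ := (hev.and self_mem_nhdsWithin).exists
    have e : ∀ y, t • y + (s - t • x₀) = s + t • (y - x₀) := fun y => by module
    refine ⟨t, s - t • x₀, ht, fun y hy => ?_⟩
    rw [e, hY y hy]
    refine ⟨fun hmem => ?_, hev y hy⟩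
    rintro rfl
    have := hmax' _ hmem
    rw [map_add, map_smul, map_sub, hx₀, smul_eq_mul] at this
    have : 0 < t * (f y - (a + f y) / 2) := mul_pos ht (by linarith)
    linarith

theorem faceCount_isFace_zero_zero {S : Set Pt} (hS : NiceShape S) (R : Finset Pt) :
    (faceCount (IsFace S) R 0 0 : ℤ) = 1 - R.card - shiftedLeftCount IsLeft R 0 := by
  classical
  rw [faceCount_isFace_zero, Finset.filter_true_of_mem]
  · simp [shiftedLeftCount]
  · intro Y hY
    rw [Finset.powersetCard_zero, Finset.mem_singleton] at hY
    rw [hY]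
    exact capt_empty hS.2.2.1 R

theorem faceCount_isFace_zero_one {S : Set Pt} (hS : NiceShape S) (R : Finset Pt) :
    (faceCount (IsFace S) R 0 1 : ℤ) = R.card - shiftedLeftCount IsLeft R 1 := by
  classical
  rw [faceCount_isFace_zero, Finset.filter_true_of_mem]
  · simp [shiftedLeftCount, fewLeftCount]
  · intro Y hY
    obtain ⟨x, rfl⟩ := Finset.card_eq_one.1 (Finset.mem_powersetCard.1 hY).2
    exact capt_singleton hS.1 hS.2.2.1 R x

theorem faceCount_isFace_zero_card {S : Set Pt} (hS : NiceShape S) (R : Finset Pt) :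
    (faceCount (IsFace S) R 0 R.card : ℤ) =
      R.card * (R.card - 1) + 1 - shiftedLeftCount IsLeft R R.card := by
  classical
  rw [faceCount_isFace_zero, Finset.filter_true_of_mem, shiftedLeftCount_card]
  · simp
  · intro Y hY
    rw [Finset.powersetCard_self, Finset.mem_singleton] at hY
    rw [hY]
    exact capt_self hS.interior_nonempty R

theorem faceCount_isFace_zero_pred {S : Set Pt} (hS : NiceShape S) {R : Finset Pt}
    (hR : NoThreeCollinear R) (h : 1 ≤ R.card) :
    (faceCount (IsFace S) R 0 (R.card - 1) : ℤ) =
      R.card * (R.card - 1) - shiftedLeftCount IsLeft R (R.card - 1) := by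
  classical
  rcases h.eq_or_lt with h | h
  · rw [← h, Nat.sub_self, faceCount_isFace_zero_zero hS, ← h]
    simp
  · rw [← card_halfplaneCapt_pred hR h, faceCount_isFace_zero]
    congr 2
    refine Finset.filter_congr fun Y hY => ?_
    rw [Finset.mem_powersetCard] at hY
    have hcard : (R \ Y).card = 1 := by
      have := Finset.card_sdiff_add_card_eq_card hY.1
      omega
    obtain ⟨x, hx⟩ := Finset.card_eq_one.1 hcard
    have hmem : ∀ y, y ∈ R \ Y ↔ y = x := fun y => by rw [hx, Finset.mem_singleton]
    refine capt_iff_halfplaneCapt hS (Finset.mem_sdiff.1 ((hmem x).2 rfl)).1 fun y hy => ?_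
    rw [ne_eq, ← hmem, Finset.mem_sdiff]
    tauto

open Classical in
theorem ncard_capturedSets (S : Set Pt) (X : Finset Pt) (k : ℕ) :
    (capturedSets S X k).ncard = ((X.powersetCard k).filter fun Y => Capt S X Y).card := by
  unfold capturedSets
  rw [ncard_setOf_subset_eq_card]
  congr 1
  refine Finset.filter_congr fun Y hY => ?_
  rw [Finset.mem_powersetCard] at hY
  constructor
  · rintro ⟨T, hT, h⟩
    obtain ⟨r, u, hr, rfl⟩ := isRange_iff.1 hT
    refine ⟨r, u, hr, fun x hx => ?_⟩
    rw [← Finset.mem_coe (s := Y), ← h]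
    exact ⟨fun hxS => ⟨hx, hxS⟩, fun hxS => hxS.2⟩
  · rintro ⟨r, u, hr, h⟩
    refine ⟨_, isRange_iff.2 ⟨r, u, hr, rfl⟩, ?_⟩
    ext x
    exact ⟨fun hx => (h x hx.1).1 hx.2, fun hx => ⟨hY.1 hx, (h x (hY.1 hx)).2 hx⟩⟩

/-- for a nice shape `S` and `X` in general position with respect to
`S`, the number of hyperedges of `ℋ(X,S,k)` is exactly
`(2k−1)|X| − k² + 1 − ∑_{i=1}^{k−1} aᵢ`. -/
theorem capturing_hypergraph_density_exact
    (S : Set Pt) (hS : NiceShape S) (X : Finset Pt) (hX : GenPos S X)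
    (k : ℕ) (hk : 1 ≤ k) (hkX : k ≤ X.card) :
    ((capturedSets S X k).ncard : ℤ) =
      (2 * (k : ℤ) - 1) * X.card - (k : ℤ) ^ 2 + 1 -
        ∑ i ∈ Finset.Icc 1 (k - 1), ((iSets X i).ncard : ℤ) := by
  have hfour : ∀ R ⊆ X, NoFourOnBoundary S R := fun R hR => hX.2.2.mono hR
  have hcol : ∀ R ⊆ X, NoThreeCollinear R := fun R hR => hX.noThreeCollinear.mono hR
  rw [ncard_capturedSets, ← faceCount_isFace_zero]
  simp only [ncard_iSets]
  rw [← shiftedLeftCount_eq_sum hX.noThreeCollinear hk hkX]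
  exact faceCount_eq_of_deletion (IsFace S) (shiftedLeftCount IsLeft) X
    (fun R hR w hw B hB Y hY hdisj => isFace_erase_iff hS (hfour R hR) hw hB hY hdisj)
    (fun R _ w _ B _ Y _ _ => isFace_insert_iff)
    (fun R hR k => faceCount_four hS (hfour R hR) k)
    (fun R _ k => sum_shiftedLeftCount_erase IsLeft isLeft_left isLeft_right R k)
    (fun R _ => faceCount_isFace_zero_zero hS R)
    (fun R _ _ => faceCount_isFace_zero_one hS R)
    (fun R hR h => faceCount_isFace_zero_pred hS (hcol R hR) h)
    (fun R _ => faceCount_isFace_zero_card hS R) X (Finset.Subset.refl X) k hkX
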